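/- Let n, r ∈ ℕ and let G be a finite abelian group with G ≅ C_n^r and Davenport constant D(G) ≥ 4. If r ≤ n − 3 and G' is a finite abelian group such that the systems of sets of lengths satisfy 𝓛(G) = 𝓛(G'), then G and G' are isomorphic. -/

import Mathlib

/- Common definitions: zero-sum sequences over a finite abelian group,
   sets of lengths, the system of sets of lengths, the Davenport constant,
   sets of distances, elasticities, AAPs, Δ₁(G), ρ(G,d,k), ρ(G,d), ρ*(G,d),
   cross numbers, K(G₀), K(G,d), LCN-sets, Δ*(G). -/

open scoped Classical

section Defs

variable {G : Type*} [AddCommGroup G]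

/-- The support of a sequence (multiset) over `G`. -/
def suppSet (A : Multiset G) : Set G := {g | g ∈ A}

/-- `A` is a minimal zero-sum sequence (an atom of `𝓑(G₀)`) over `G₀ ⊆ G`:
a nontrivial zero-sum sequence with terms in `G₀` such that every proper
nontrivial subsequence has nonzero sum. -/
def IsMinZeroSum (G0 : Set G) (A : Multiset G) : Prop :=
  A ≠ 0 ∧ (∀ g ∈ A, g ∈ G0) ∧ A.sum = 0 ∧
    ∀ T : Multiset G, T ≤ A → T.sum = 0 → T = 0 ∨ T = A

/-- `B` is a zero-sum sequence over `G₀ ⊆ G` (an element of `𝓑(G₀)`). -/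
def IsZeroSumSeq (G0 : Set G) (B : Multiset G) : Prop :=
  (∀ g ∈ B, g ∈ G0) ∧ B.sum = 0

/-- The set of lengths `L(B)` of a zero-sum sequence `B` over `G₀`:
all `k` such that `B` is a product of `k` atoms of `𝓑(G₀)`.
(For the trivial sequence this is `{0}`.) -/
def lengthSet (G0 : Set G) (B : Multiset G) : Set ℕ :=
  {k | ∃ U : Fin k → Multiset G, (∀ i, IsMinZeroSum G0 (U i)) ∧ B = ∑ i, U i}

/-- The system of sets of lengths `𝓛(G₀)`. -/
def systemL (G0 : Set G) : Set (Set ℕ) :=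
  {L | ∃ B : Multiset G, IsZeroSumSeq G0 B ∧ L = lengthSet G0 B}

/-- The Davenport constant `D(G)`: the maximal length of a minimal zero-sum
sequence over `G`. -/
noncomputable def davenport (G : Type*) [AddCommGroup G] : ℕ :=
  sSup {m | ∃ A : Multiset G, IsMinZeroSum (Set.univ : Set G) A ∧ Multiset.card A = m}

/-- The set of successive distances `Δ(L)` of a set `L ⊆ ℕ`. -/
def deltaOf (L : Set ℕ) : Set ℕ :=
  {d | 0 < d ∧ ∃ a, a ∈ L ∧ a + d ∈ L ∧ ∀ c ∈ L, ¬(a < c ∧ c < a + d)}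

/-- `Δ(G₀) = ⋃_{L ∈ 𝓛(G₀)} Δ(L)`. -/
def deltaG0 (G0 : Set G) : Set ℕ := ⋃ L ∈ systemL G0, deltaOf L

/-- `Δ*(G) = {min Δ(G₀) : G₀ ⊆ G with Δ(G₀) ≠ ∅}`. -/
def deltaStar (G : Type*) [AddCommGroup G] : Set ℕ :=
  {d | ∃ G0 : Set G, deltaG0 G0 ≠ ∅ ∧ d = sInf (deltaG0 G0)}

/-- The elasticity `ρ(L) = max L / min L` of a (finite) set `L ⊆ ℕ`,
with the convention `ρ({0}) = 1`. -/
noncomputable def rhoL (L : Set ℕ) : ℝ :=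
  if sInf L = 0 then 1 else ((sSup L : ℕ) : ℝ) / ((sInf L : ℕ) : ℝ)

/-- The elasticity `ρ(G₀) = sup {ρ(L) : L ∈ 𝓛(G₀)}`. -/
noncomputable def rhoG0 (G0 : Set G) : ℝ := sSup (rhoL '' systemL G0)

/-- `L` (a set of naturals) is an almost arithmetical progression (AAP)
with difference `d`, length `ℓ` and bound `M`:
`L = y + (L' ∪ {0, d, …, ℓd} ∪ L'') ⊆ y + dℤ` with `L' ⊆ [−M, −1]` and
`L'' ⊆ ℓd + [1, M]`. -/
def IsAAP (L : Set ℕ) (d ℓ M : ℕ) : Prop :=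
  ∃ (y : ℤ) (L1 L2 : Set ℤ),
    L1 ⊆ Set.Icc (-(M : ℤ)) (-1) ∧
    L2 ⊆ Set.Icc ((ℓ : ℤ) * d + 1) ((ℓ : ℤ) * d + M) ∧
    ((fun x : ℕ => (x : ℤ)) '' L) =
      (fun x => y + x) '' (L1 ∪ (fun i : ℤ => (d : ℤ) * i) '' Set.Icc (0 : ℤ) (ℓ : ℤ) ∪ L2) ∧
    (∀ x ∈ L, (d : ℤ) ∣ ((x : ℤ) - y))

/-- `Δ₁(G)`: the set of `d ∈ ℕ` such that for every `k` there is some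
`L ∈ 𝓛(G)` which is an AAP with difference `d` and length at least `k`. -/
def delta1 (G : Type*) [AddCommGroup G] : Set ℕ :=
  {d | 0 < d ∧ ∀ k : ℕ, ∃ L ∈ systemL (Set.univ : Set G), ∃ ℓ ≥ k, ∃ M : ℕ, IsAAP L d ℓ M}

/-- `ρ(G, d, k)`: the supremum of elasticities of sets of lengths of `G` which
are AAPs with difference `d` and length at least `k`. -/
noncomputable def rhoGdk (G : Type*) [AddCommGroup G] (d k : ℕ) : ℝ :=
  sSup (rhoL '' {L | L ∈ systemL (Set.univ : Set G) ∧ ∃ ℓ ≥ k, ∃ M : ℕ, IsAAP L d ℓ M})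

/-- `ρ(G, d)`: the limit of the decreasing sequence `(ρ(G, d, k))_k`,
i.e. its infimum. -/
noncomputable def rhoGd (G : Type*) [AddCommGroup G] (d : ℕ) : ℝ :=
  ⨅ k : ℕ, rhoGdk G d k

/-- `ρ*(G, d) = max {ρ(G₀) : G₀ ⊆ G non-half-factorial with d ∣ min Δ(G₀)}`. -/
noncomputable def rhoStar (G : Type*) [AddCommGroup G] (d : ℕ) : ℝ :=
  sSup {x | ∃ G0 : Set G, deltaG0 G0 ≠ ∅ ∧ d ∣ sInf (deltaG0 G0) ∧ x = rhoG0 G0}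

/-- The cross number `k(S) = Σ_{g ∈ S} 1/ord(g)` of a sequence `S`. -/
noncomputable def crossNum (S : Multiset G) : ℝ :=
  (S.map (fun g => (1 : ℝ) / (addOrderOf g))).sum

/-- `K(G₀) = max {k(A) : A ∈ 𝓐(G₀)}`, the cross number of `G₀`. -/
noncomputable def KG0 (G0 : Set G) : ℝ :=
  sSup {x | ∃ A : Multiset G, IsMinZeroSum G0 A ∧ x = crossNum A}

/-- `K(G, d) = max {K(G₀) : G₀ ⊆ G non-half-factorial with d ∣ min Δ(G₀)}`. -/
noncomputable def KGd (G : Type*) [AddCommGroup G] (d : ℕ) : ℝ :=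
  sSup {x | ∃ G0 : Set G, deltaG0 G0 ≠ ∅ ∧ d ∣ sInf (deltaG0 G0) ∧ x = KG0 G0}

/-- `G₀` is an LCN-set: `k(A) ≥ 1` for every atom `A` of `𝓑(G₀)`. -/
def IsLCN (G0 : Set G) : Prop :=
  ∀ A : Multiset G, IsMinZeroSum G0 A → 1 ≤ crossNum A

end Defs

namespace SL

variable {Γ : Type*} [AddCommGroup Γ]

/-- A multiset of atoms over `G0`. -/
def Fac (G0 : Set Γ) (s : Multiset (Multiset Γ)) : Prop := ∀ A ∈ s, IsMinZeroSum G0 A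

/-- All lengths of factorizations over `G0` are congruent modulo `d`. -/
def DvdD (d : ℕ) (G0 : Set Γ) : Prop :=
  ∀ s s' : Multiset (Multiset Γ), Fac G0 s → Fac G0 s' → s.sum = s'.sum →
    (d : ℤ) ∣ ((Multiset.card s : ℤ) - (Multiset.card s' : ℤ))


noncomputable def wt (n : ℕ) (B : Multiset Γ) : ℕ := (B.map fun g => n / addOrderOf g).sum

theorem mem_lengthSet_iff {G0 : Set Γ} {B : Multiset Γ} {k : ℕ} :
    k ∈ lengthSet G0 B ↔ ∃ s, Fac G0 s ∧ s.sum = B ∧ Multiset.card s = k := by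
  constructor
  · rintro ⟨U, hU, rfl⟩
    refine ⟨(Finset.univ : Finset (Fin k)).val.map U, ?_, rfl, by simp⟩
    intro A hA
    simp only [Multiset.mem_map] at hA
    obtain ⟨i, _, rfl⟩ := hA
    exact hU i
  · rintro ⟨s, hs, rfl, rfl⟩
    induction s using Quotient.inductionOn with
    | h l =>
      refine ⟨fun i => l.get (i.cast (by simp)), fun i => hs _ (by simp), ?_⟩
      have : ∀ (m : ℕ) (h : m = l.length), ∑ i : Fin m, l.get (i.cast h) = l.sum := by
        rintro m rfl
        simp
      exact (Multiset.sum_coe l).trans (this _ (by simp)).symm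

theorem Fac.add {G0 : Set Γ} {s t : Multiset (Multiset Γ)} (hs : Fac G0 s) (ht : Fac G0 t) :
    Fac G0 (s + t) := by
  intro A hA
  rcases Multiset.mem_add.1 hA with h | h
  exacts [hs A h, ht A h]

theorem Fac.le {G0 : Set Γ} {s t : Multiset (Multiset Γ)} (hs : Fac G0 s) (ht : t ≤ s) :
    Fac G0 t := fun A hA => hs A (Multiset.mem_of_le ht hA)

theorem Fac.replicate {G0 : Set Γ} {A : Multiset Γ} (hA : IsMinZeroSum G0 A) (k : ℕ) :
    Fac G0 (Multiset.replicate k A) := fun B hB => by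
  rw [Multiset.eq_of_mem_replicate hB]; exact hA

theorem IsMinZeroSum.mono' {G0 G1 : Set Γ} {A : Multiset Γ} (hA : IsMinZeroSum G0 A)
    (h : ∀ g ∈ A, g ∈ G1) : IsMinZeroSum G1 A := ⟨hA.1, h, hA.2.2.1, hA.2.2.2⟩

theorem IsMinZeroSum.mono {G0 G1 : Set Γ} {A : Multiset Γ} (hA : IsMinZeroSum G0 A)
    (h : G0 ⊆ G1) : IsMinZeroSum G1 A := ⟨hA.1, fun g hg => h (hA.2.1 g hg), hA.2.2.1, hA.2.2.2⟩

theorem Fac.mono {G0 G1 : Set Γ} {s : Multiset (Multiset Γ)} (hs : Fac G0 s)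
    (h : G0 ⊆ G1) : Fac G1 s := fun A hA => IsMinZeroSum.mono (hs A hA) h

theorem DvdD.mono {G0 G1 : Set Γ} {d : ℕ} (hs : DvdD d G1) (h : G0 ⊆ G1) : DvdD d G0 :=
  fun s s' a b c => hs s s' (a.mono h) (b.mono h) c

theorem mem_sum_mem {s : Multiset (Multiset Γ)} {g : Γ} : g ∈ s.sum ↔ ∃ A ∈ s, g ∈ A := by
  induction s using Multiset.induction_on with
  | empty => simp
  | cons a s ih => simp [ih]

theorem Fac.mem {G0 : Set Γ} {s : Multiset (Multiset Γ)} (hs : Fac G0 s) :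
    ∀ g ∈ s.sum, g ∈ G0 := by
  intro g hg
  obtain ⟨A, hA, h⟩ := mem_sum_mem.1 hg
  exact (hs A hA).2.1 g h

theorem Fac.restrict {G0 G1 : Set Γ} {s : Multiset (Multiset Γ)} (hs : Fac G0 s)
    (h : ∀ g ∈ s.sum, g ∈ G1) : Fac G1 s := fun A hA =>
  IsMinZeroSum.mono' (hs A hA) fun g hg => h g (mem_sum_mem.2 ⟨A, hA, hg⟩)

theorem Fac.sum_sum {G0 : Set Γ} {s : Multiset (Multiset Γ)} (hs : Fac G0 s) :
    s.sum.sum = 0 := by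
  induction s using Multiset.induction_on with
  | empty => simp
  | cons a s ih =>
    rw [Multiset.sum_cons, Multiset.sum_add, (hs a (by simp)).2.2.1,
      ih (fun A hA => hs A (by simp [hA])), add_zero]

theorem exists_atom_le {G0 : Set Γ} {B : Multiset Γ} (hB : IsZeroSumSeq G0 B) (h0 : B ≠ 0) :
    ∃ A ≤ B, IsMinZeroSum G0 A := by
  induction hc : Multiset.card B using Nat.strong_induction_on generalizing B with
  | _ k ih =>
    by_cases h : ∃ T ≤ B, T.sum = 0 ∧ T ≠ 0 ∧ T ≠ B
    · obtain ⟨T, hT, hs, h1, h2⟩ := h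
      obtain ⟨A, hA, hA'⟩ := ih (Multiset.card T)
        (hc ▸ Multiset.card_lt_card (lt_of_le_of_ne hT h2)) ⟨fun g hg => hB.1 g (Multiset.mem_of_le hT hg), hs⟩ h1 rfl
      exact ⟨A, hA.trans hT, hA'⟩
    · push Not at h
      refine ⟨B, le_rfl, h0, hB.1, hB.2, fun T hT hs => ?_⟩
      by_cases h1 : T = 0
      · exact Or.inl h1
      · exact Or.inr (h T hT hs h1)

theorem sum_sub_eq {A B : Multiset Γ} (h : A ≤ B) : (B - A).sum = B.sum - A.sum := by
  have := congrArg Multiset.sum (Multiset.sub_add_cancel h)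
  rw [Multiset.sum_add] at this
  exact eq_sub_of_add_eq this

theorem exists_fac {G0 : Set Γ} {B : Multiset Γ} (hB : IsZeroSumSeq G0 B) :
    ∃ s, Fac G0 s ∧ s.sum = B := by
  induction hc : Multiset.card B using Nat.strong_induction_on generalizing B with
  | _ k ih =>
    by_cases h0 : B = 0
    · exact ⟨0, fun A hA => by simp at hA, by simp [h0]⟩
    · obtain ⟨A, hA, hA'⟩ := exists_atom_le hB h0
      have hle : B - A ≤ B := Multiset.sub_le_self _ _
      obtain ⟨s, hs, hs'⟩ := ih (Multiset.card (B - A)) (by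
        have : 0 < Multiset.card A := Multiset.card_pos.2 hA'.1
        have h2 := Multiset.card_le_card hA
        rw [Multiset.card_sub hA]; omega)
        ⟨fun g hg => hB.1 g (Multiset.mem_of_le hle hg), by
          rw [sum_sub_eq hA, hB.2, hA'.2.2.1, sub_zero]⟩ rfl
      refine ⟨A ::ₘ s, ?_, ?_⟩
      · intro C hC
        rcases Multiset.mem_cons.1 hC with rfl | h
        exacts [hA', hs C h]
      · rw [Multiset.sum_cons, hs', add_comm, Multiset.sub_add_cancel hA]

theorem sum_replicate_order (g : Γ) : (Multiset.replicate (addOrderOf g) g).sum = 0 := by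
  simp [addOrderOf_nsmul_eq_zero]

theorem atom_eq_of_order_le {G0 : Set Γ} {A : Multiset Γ} (hA : IsMinZeroSum G0 A) {g : Γ}
    (ho : 0 < addOrderOf g) (h : addOrderOf g ≤ A.count g) :
    A = Multiset.replicate (addOrderOf g) g := by
  have h1 := hA.2.2.2 _ (Multiset.le_count_iff_replicate_le.1 h) (sum_replicate_order g)
  rcases h1 with h1 | h1
  · have := congrArg Multiset.card h1
    rw [Multiset.card_replicate, Multiset.card_zero] at this; omega
  · exact h1.symm

theorem atom_count_le {G0 : Set Γ} {A : Multiset Γ} (hA : IsMinZeroSum G0 A) {g : Γ}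
    (ho : 0 < addOrderOf g) : A.count g ≤ addOrderOf g := by
  by_contra h
  have := atom_eq_of_order_le hA ho (by omega)
  rw [this, Multiset.count_replicate_self] at h
  omega

theorem atom_replicate {G0 : Set Γ} {g : Γ} (hg : g ∈ G0) (ho : 0 < addOrderOf g) :
    IsMinZeroSum G0 (Multiset.replicate (addOrderOf g) g) := by
  refine ⟨fun h => ?_, fun x hx => ?_, sum_replicate_order g, fun T hT hs => ?_⟩
  · have := congrArg Multiset.card h
    rw [Multiset.card_replicate, Multiset.card_zero] at this; omega
  · rw [Multiset.eq_of_mem_replicate hx]; exact hg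
  · obtain ⟨k, hk, rfl⟩ := Multiset.le_replicate_iff.1 hT
    simp only [Multiset.sum_replicate] at hs
    have h1 := addOrderOf_dvd_of_nsmul_eq_zero hs
    by_cases h0 : k = 0
    · left; simp [h0]
    · right
      rw [le_antisymm hk (Nat.le_of_dvd (by omega) h1)]

section wt
variable {n : ℕ}

@[simp] theorem wt_zero : wt n (0 : Multiset Γ) = 0 := by simp [wt]
@[simp] theorem wt_add (A B : Multiset Γ) : wt n (A + B) = wt n A + wt n B := by simp [wt]
theorem wt_replicate (k : ℕ) (g : Γ) : wt n (Multiset.replicate k g) = k * (n / addOrderOf g) := by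
  simp [wt]
theorem wt_nsmul (k : ℕ) (A : Multiset Γ) : wt n (k • A) = k * wt n A := by
  induction k with
  | zero => simp
  | succ k ih => rw [succ_nsmul, wt_add, ih]; ring
theorem wt_cons (g : Γ) (A : Multiset Γ) : wt n (g ::ₘ A) = n / addOrderOf g + wt n A := by
  simp [wt]
theorem wt_sum (s : Multiset (Multiset Γ)) : wt n s.sum = (s.map (wt n)).sum := by
  induction s using Multiset.induction_on with
  | empty => simp
  | cons a s ih => simp [ih]
theorem wt_le {A B : Multiset Γ} (h : A ≤ B) : wt n A ≤ wt n B := by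
  rw [← Multiset.sub_add_cancel h, wt_add]; omega
theorem wt_sub {A B : Multiset Γ} (h : A ≤ B) : wt n (B - A) + wt n A = wt n B := by
  rw [← wt_add, Multiset.sub_add_cancel h]

theorem order_pos (hn : 0 < n) (hΓ : ∀ g : Γ, n • g = 0) (g : Γ) : 0 < addOrderOf g :=
  Nat.pos_of_dvd_of_pos (addOrderOf_dvd_of_nsmul_eq_zero (hΓ g)) hn
theorem order_dvd (hΓ : ∀ g : Γ, n • g = 0) (g : Γ) : addOrderOf g ∣ n :=
  addOrderOf_dvd_of_nsmul_eq_zero (hΓ g)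
theorem order_le (hn : 0 < n) (hΓ : ∀ g : Γ, n • g = 0) (g : Γ) : addOrderOf g ≤ n :=
  Nat.le_of_dvd hn (order_dvd hΓ g)
theorem div_order_pos (hn : 0 < n) (hΓ : ∀ g : Γ, n • g = 0) (g : Γ) : 0 < n / addOrderOf g :=
  Nat.div_pos (order_le hn hΓ g) (order_pos hn hΓ g)

theorem wt_order (hΓ : ∀ g : Γ, n • g = 0) (g : Γ) :
    wt n (Multiset.replicate (addOrderOf g) g) = n := by
  rw [wt_replicate, Nat.mul_div_cancel' (order_dvd hΓ g)]

theorem card_le_wt (hn : 0 < n) (hΓ : ∀ g : Γ, n • g = 0) (A : Multiset Γ) :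
    Multiset.card A ≤ wt n A := by
  induction A using Multiset.induction_on with
  | empty => simp
  | cons a s ih =>
    have := div_order_pos hn hΓ a
    rw [wt_cons, Multiset.card_cons]; omega

theorem wt_le_card (A : Multiset Γ) : wt n A ≤ n * Multiset.card A := by
  induction A using Multiset.induction_on with
  | empty => simp
  | cons a s ih =>
    have := Nat.div_le_self n (addOrderOf a)
    rw [wt_cons, Multiset.card_cons, mul_add]; omega

theorem wt_pos (hn : 0 < n) (hΓ : ∀ g : Γ, n • g = 0) {A : Multiset Γ} (h : A ≠ 0) :
    0 < wt n A := lt_of_lt_of_le (Multiset.card_pos.2 h) (card_le_wt hn hΓ A)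

theorem le_wt_sum {s : Multiset (Multiset Γ)} {a : ℕ} (h : ∀ A ∈ s, a ≤ wt n A) :
    Multiset.card s * a ≤ wt n s.sum := by
  rw [wt_sum]
  have := Multiset.card_nsmul_le_sum (s := s.map (wt n)) (a := a) (by simpa using h)
  simpa using this

theorem wt_sum_le {s : Multiset (Multiset Γ)} {a : ℕ} (h : ∀ A ∈ s, wt n A ≤ a) :
    wt n s.sum ≤ Multiset.card s * a := by
  rw [wt_sum]
  have := Multiset.sum_le_card_nsmul (s.map (wt n)) a (by simpa using h)
  simpa using this

theorem wt_sum_eq {s : Multiset (Multiset Γ)} {a : ℕ} (h : ∀ A ∈ s, wt n A = a) :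
    wt n s.sum = Multiset.card s * a :=
  le_antisymm (wt_sum_le fun A hA => (h A hA).le) (le_wt_sum fun A hA => (h A hA).ge)

/-- the standard factorization of `n • A` into powers of single elements -/
noncomputable def stdFac (n : ℕ) (A : Multiset Γ) : Multiset (Multiset Γ) :=
  A.bind fun g => Multiset.replicate (n / addOrderOf g) (Multiset.replicate (addOrderOf g) g)

theorem card_stdFac (A : Multiset Γ) : Multiset.card (stdFac n A) = wt n A := by
  simp [stdFac, wt, Multiset.card_bind]

theorem sum_stdFac (hΓ : ∀ g : Γ, n • g = 0) (A : Multiset Γ) : (stdFac n A).sum = n • A := by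
  induction A using Multiset.induction_on with
  | empty => simp [stdFac]
  | cons a s ih =>
    have : stdFac n (a ::ₘ s) = Multiset.replicate (n / addOrderOf a) (Multiset.replicate (addOrderOf a) a) + stdFac n s := by
      simp [stdFac]
    rw [this, Multiset.sum_add, ih, ← Multiset.singleton_add, nsmul_add]
    congr 1
    rw [Multiset.sum_replicate, ← Multiset.nsmul_singleton, ← mul_nsmul', Nat.div_mul_cancel (order_dvd hΓ a)]

theorem fac_stdFac (hn : 0 < n) (hΓ : ∀ g : Γ, n • g = 0) {G0 : Set Γ} {A : Multiset Γ}
    (hA : ∀ g ∈ A, g ∈ G0) : Fac G0 (stdFac n A) := by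
  intro B hB
  simp only [stdFac, Multiset.mem_bind] at hB
  obtain ⟨g, hg, h⟩ := hB
  rw [Multiset.eq_of_mem_replicate h]
  exact atom_replicate (hA g hg) (order_pos hn hΓ g)

theorem wt_stdFac (hΓ : ∀ g : Γ, n • g = 0) {A B : Multiset Γ} (hB : B ∈ stdFac n A) :
    wt n B = n := by
  simp only [stdFac, Multiset.mem_bind] at hB
  obtain ⟨g, hg, h⟩ := hB
  rw [Multiset.eq_of_mem_replicate h]
  exact wt_order hΓ g

theorem dvd_wt (hn : 0 < n) (hΓ : ∀ g : Γ, n • g = 0) {d : ℕ} {G0 : Set Γ} (hd : DvdD d G0)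
    {A : Multiset Γ} (hA : IsMinZeroSum G0 A) : (d : ℤ) ∣ (n : ℤ) - wt n A := by
  have := hd (Multiset.replicate n A) (stdFac n A) (Fac.replicate hA n)
    (fac_stdFac hn hΓ hA.2.1) (by rw [sum_stdFac hΓ]; simp)
  simpa [card_stdFac] using this

end wt

/-- torsion bound: the `p`-torsion has at most `p ^ r` elements. -/
def TorLe (Γ : Type*) [AddCommGroup Γ] (r : ℕ) : Prop :=
  ∀ p : ℕ, p.Prime → Nat.card {g : Γ // p • g = 0} ≤ p ^ r

theorem rank_aux [Finite Γ] {p a r : ℕ} (hp : p.Prime)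
    (ht : Nat.card {g : Γ // p • g = 0} ≤ p ^ r) (X : Finset Γ)
    (hX : ∀ x ∈ X, p ^ a • x = 0) :
    ∃ X' ⊆ X, X'.card ≤ r ∧
      AddSubgroup.closure (X' : Set Γ) = AddSubgroup.closure (X : Set Γ) := by
  set K := AddSubgroup.closure (X : Set Γ) with hK
  have hKp : ∀ x ∈ K, p ^ a • x = 0 := by
    intro x hx
    induction hx using AddSubgroup.closure_induction with
    | mem x hx => exact hX x hx
    | zero => simp
    | add x y _ _ h1 h2 => rw [nsmul_add, h1, h2, add_zero]
    | neg x _ h => rw [smul_neg, h, neg_zero]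
  have hex : ∃ k, ∃ X' ⊆ X, X'.card = k ∧ AddSubgroup.closure (X' : Set Γ) = K :=
    ⟨_, X, le_rfl, rfl, rfl⟩
  obtain ⟨X', hXX, hc, hcl⟩ := Nat.find_spec hex
  have hmin := fun k (hk : k < Nat.find hex) => Nat.find_min hex hk
  refine ⟨X', hXX, ?_, hcl⟩
  let m : K →+ K := nsmulAddMonoidHom p
  have hXK : ∀ x ∈ X', x ∈ K := fun x hx => AddSubgroup.subset_closure (hXX hx)
  let φ : (X' → Fin p) × m.range → K := fun z =>
    ⟨∑ f : X', (z.1 f : ℕ) • (f : Γ) + (z.2 : K), K.add_mem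
      (K.sum_mem fun f _ => K.nsmul_mem (hXK f f.2) _) (z.2 : K).2⟩
  have hφ : Function.Injective φ := by
    rintro ⟨c, y⟩ ⟨c', y'⟩ h
    have h1 : ∑ f : X', (c f : ℕ) • (f : Γ) + (y : K) = ∑ f : X', (c' f : ℕ) • (f : Γ) + (y' : K) :=
      congrArg Subtype.val h
    have hcc : c = c' := by
      by_contra hne
      obtain ⟨f, hf⟩ := Function.ne_iff.1 hne
      set K' := AddSubgroup.closure ((X'.erase f : Finset Γ) : Set Γ) with hK'
      obtain ⟨v, hv⟩ := y.2
      obtain ⟨v', hv'⟩ := y'.2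
      have hvv : ((y : K) : Γ) = p • (v : Γ) := by rw [← hv]; rfl
      have hvv' : ((y' : K) : Γ) = p • (v' : Γ) := by rw [← hv']; rfl
      rw [hvv, hvv'] at h1
      have h2 : ∃ u ∈ K', ∃ w ∈ K, ((c f : ℤ) - (c' f : ℤ)) • (f : Γ) = u + p • w := by
        refine ⟨∑ x ∈ Finset.univ.erase f, ((c' x : ℤ) - (c x : ℤ)) • (x : Γ),
          K'.sum_mem fun x hx => K'.zsmul_mem (AddSubgroup.subset_closure ?_) _,
          (v' : Γ) - v, K.sub_mem v'.2 v.2, ?_⟩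
        · simp only [Finset.mem_erase] at hx
          have : (x : Γ) ≠ f := fun h => hx.1 (Subtype.ext h)
          simp [this]
        · have h3 : ∑ x : X', ((c x : ℤ) - (c' x : ℤ)) • (x : Γ) = p • ((v' : Γ) - v) := by
            simp only [sub_smul, Finset.sum_sub_distrib, natCast_zsmul, nsmul_sub]
            rw [sub_eq_sub_iff_add_eq_add, h1, add_comm]
          rw [← Finset.add_sum_erase _ _ (Finset.mem_univ f)] at h3
          rw [← h3]
          have h4 : ∑ x ∈ Finset.univ.erase f, ((c' x : ℤ) - (c x : ℤ)) • (x : Γ) =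
            - ∑ x ∈ Finset.univ.erase f, ((c x : ℤ) - (c' x : ℤ)) • (x : Γ) := by
            rw [← Finset.sum_neg_distrib]
            exact Finset.sum_congr rfl fun x _ => by rw [← neg_smul, neg_sub]
          rw [h4]; abel
      have hcop : IsCoprime ((c f : ℤ) - (c' f : ℤ)) (p : ℤ) := by
        rw [isCoprime_comm]
        refine ((Nat.prime_iff_prime_int.1 hp).coprime_iff_not_dvd).2 ?_
        intro hdvd
        apply hf
        have h5 := (c f).2
        have h6 := (c' f).2
        have : (c f : ℤ) - (c' f : ℤ) = 0 := Int.eq_zero_of_abs_lt_dvd hdvd (by rw [abs_lt]; constructor <;> omega)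
        exact Fin.ext (by omega)
      have hfK : (f : Γ) ∈ K := hXK f f.2
      have hK'K : K' ≤ K := by
        rw [hK', AddSubgroup.closure_le]
        intro x hx
        exact hXK x (Finset.mem_of_mem_erase hx)
      have h3 : ∃ u ∈ K', ∃ w ∈ K, (f : Γ) = u + p • w := by
        obtain ⟨s, t, hst⟩ := hcop
        obtain ⟨u, hu, w, hw, h2⟩ := h2
        refine ⟨s • u, K'.zsmul_mem hu s, s • w + t • (f : Γ), K.add_mem (K.zsmul_mem hw s) (K.zsmul_mem hfK t), ?_⟩
        calc (f : Γ) = (s * ((c f : ℤ) - (c' f : ℤ)) + t * p) • (f : Γ) := by rw [hst, one_smul]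
          _ = s • (u + p • w) + t • ((p : ℤ) • (f : Γ)) := by rw [add_smul, mul_smul, h2, mul_smul]
          _ = _ := by
            simp only [smul_add, natCast_zsmul, smul_comm t p, smul_comm s p]
            abel
      have h4 : ∀ x ∈ K, ∃ u ∈ K', ∃ w ∈ K, x = u + p • w := by
        intro x hx
        rw [← hcl] at hx
        induction hx using AddSubgroup.closure_induction with
        | mem x hx =>
          by_cases hxf : x = f
          · rw [hxf]; exact h3
          · exact ⟨x, AddSubgroup.subset_closure (by simpa [hxf] using hx), 0, K.zero_mem, by simp⟩
        | zero => exact ⟨0, K'.zero_mem, 0, K.zero_mem, by simp⟩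
        | add x y _ _ h1 h2 =>
          obtain ⟨u, hu, w, hw, rfl⟩ := h1
          obtain ⟨u', hu', w', hw', rfl⟩ := h2
          exact ⟨u + u', K'.add_mem hu hu', w + w', K.add_mem hw hw', by rw [nsmul_add]; abel⟩
        | neg x _ h =>
          obtain ⟨u, hu, w, hw, rfl⟩ := h
          exact ⟨-u, K'.neg_mem hu, -w, K.neg_mem hw, by rw [smul_neg]; abel⟩
      have h5 : ∀ i : ℕ, ∀ x ∈ K, ∃ u ∈ K', ∃ w ∈ K, x = u + p ^ i • w := by
        intro i
        induction i with
        | zero => intro x hx; exact ⟨0, K'.zero_mem, x, hx, by simp⟩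
        | succ i ih =>
          intro x hx
          obtain ⟨u, hu, w, hw, rfl⟩ := ih x hx
          obtain ⟨u', hu', w', hw', rfl⟩ := h4 w hw
          refine ⟨u + p ^ i • u', K'.add_mem hu (K'.nsmul_mem hu' _), w', hw', ?_⟩
          rw [nsmul_add, pow_succ, mul_smul]; abel
      have h6 : K' = K := by
        refine le_antisymm hK'K fun x hx => ?_
        obtain ⟨u, hu, w, hw, rfl⟩ := h5 a x hx
        rw [hKp w hw, add_zero]; exact hu
      have hlt : (X'.erase (f : Γ)).card < Nat.find hex := by
        rw [← hc]; exact Finset.card_erase_lt_of_mem f.2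
      exact hmin _ hlt ⟨X'.erase (f : Γ), (Finset.erase_subset _ _).trans hXX, rfl, h6⟩
    subst hcc
    have : y = y' := by
      apply Subtype.ext; apply Subtype.ext
      exact add_left_cancel h1
    rw [this]
  have h1 : Nat.card ((X' → Fin p) × m.range) ≤ Nat.card K := Nat.card_le_card_of_injective φ hφ
  rw [Nat.card_prod, Nat.card_fun, Nat.card_fin, Nat.card_eq_fintype_card, Fintype.card_coe] at h1
  have h2 : Nat.card m.range * Nat.card m.ker = Nat.card K := by
    rw [mul_comm, ← AddSubgroup.index_ker]
    exact AddSubgroup.card_mul_index m.ker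
  have h3 : Nat.card m.ker ≤ p ^ r := by
    refine le_trans (Nat.card_le_card_of_injective
      (fun x : m.ker => (⟨((x : K) : Γ), ?_⟩ : {g : Γ // p • g = 0})) ?_) ht
    · have := x.2
      rw [AddMonoidHom.mem_ker] at this
      exact congrArg Subtype.val this
    · intro x y hxy
      exact Subtype.ext (Subtype.ext (Subtype.mk.inj hxy))
  have h4 : 0 < Nat.card m.range := Nat.card_pos
  have h5 : p ^ X'.card ≤ p ^ r := by
    rw [← h2, mul_comm] at h1
    exact (Nat.le_of_mul_le_mul_left h1 h4).trans h3
  exact (Nat.pow_le_pow_iff_right hp.one_lt).1 h5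

theorem rank_lemma [Finite Γ] {n p a q r : ℕ} (hΓ : ∀ g : Γ, n • g = 0) (hn : n = p ^ a * q)
    (hp : p.Prime) (ht : Nat.card {g : Γ // p • g = 0} ≤ p ^ r) (F : Finset Γ) :
    ∃ F' ⊆ F, F'.card ≤ r ∧ ∀ f ∈ F,
      q • f ∈ AddSubgroup.closure ((F'.image fun x => q • x : Finset Γ) : Set Γ) := by
  obtain ⟨X', hX, hc, hcl⟩ := rank_aux (a := a) hp ht (F.image fun x => q • x) (by
    intro x hx
    obtain ⟨f, _, rfl⟩ := Finset.mem_image.1 hx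
    rw [← mul_smul, ← hn, hΓ])
  obtain ⟨F', hF', h2, h1⟩ := Finset.exists_subset_injOn_image_eq_of_surjOn F X' (f := fun x => q • x) (fun x hx => by simpa using hX hx)
  have h2 := Finset.card_image_of_injOn h2
  rw [h1] at h2
  refine ⟨F', hF', by omega, fun f hf => ?_⟩
  rw [h1, hcl]
  exact AddSubgroup.subset_closure (by simpa using ⟨f, hf, rfl⟩)

/-- elements of the closure of a finset are natural combinations -/
theorem closure_nat {n : ℕ} (hn : 0 < n) (hΓ : ∀ g : Γ, n • g = 0) (F : Finset Γ) (x : Γ)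
    (hx : x ∈ AddSubgroup.closure (F : Set Γ)) : ∃ c : Γ → ℕ, x = ∑ f ∈ F, c f • f := by
  induction hx using AddSubgroup.closure_induction with
  | mem x hx =>
    refine ⟨fun f => if f = x then 1 else 0, ?_⟩
    simp only [ite_smul, one_smul, zero_smul]
    rw [Finset.sum_ite_eq' F x]
    simp only [Finset.mem_coe] at hx
    simp [hx]
  | zero => exact ⟨fun _ => 0, by simp⟩
  | add x y _ _ h1 h2 =>
    obtain ⟨c, rfl⟩ := h1
    obtain ⟨c', rfl⟩ := h2
    exact ⟨fun f => c f + c' f, by simp [add_smul, Finset.sum_add_distrib]⟩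
  | neg x _ h =>
    obtain ⟨c, rfl⟩ := h
    refine ⟨fun f => (n - 1) * c f, ?_⟩
    rw [← Finset.sum_neg_distrib]
    refine Finset.sum_congr rfl fun f _ => ?_
    rw [neg_eq_iff_add_eq_zero, ← add_smul]
    have : c f + (n - 1) * c f = c f * n := by
      obtain ⟨k, rfl⟩ : ∃ k, n = k + 1 := ⟨n - 1, by omega⟩
      simp; ring
    rw [this, mul_smul, hΓ, smul_zero]

/-- the atom `x ^ ord x` -/
noncomputable def OO (x : Γ) : Multiset Γ := Multiset.replicate (addOrderOf x) x

/-- sums of atoms of weight exactly `n` -/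
def Full (n : ℕ) (E : Set Γ) (Z : Multiset Γ) : Prop :=
  ∃ s, Fac E s ∧ (∀ A ∈ s, wt n A = n) ∧ s.sum = Z

theorem Full.zero (n : ℕ) (E : Set Γ) : Full n E 0 := ⟨0, fun A hA => by simp at hA, fun A hA => by simp at hA, by simp⟩

theorem Full.add {n : ℕ} {E : Set Γ} {Z W : Multiset Γ} (h : Full n E Z) (h' : Full n E W) :
    Full n E (Z + W) := by
  obtain ⟨s, h1, h2, rfl⟩ := h
  obtain ⟨t, h3, h4, rfl⟩ := h'
  refine ⟨s + t, h1.add h3, fun A hA => ?_, by simp⟩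
  rcases Multiset.mem_add.1 hA with h | h
  exacts [h2 A h, h4 A h]

/-- eventually full -/
def QQ (n : ℕ) (E : Set Γ) (Z : Multiset Γ) : Prop :=
  ∃ m : Multiset Γ, (∀ x ∈ m, x ∈ E) ∧ Full n E (Z + (m.map OO).sum)

theorem QQ.add {n : ℕ} {E : Set Γ} {Z W : Multiset Γ} (h : QQ n E Z) (h' : QQ n E W) :
    QQ n E (Z + W) := by
  obtain ⟨s, h1, h2⟩ := h
  obtain ⟨t, h3, h4⟩ := h'
  refine ⟨s + t, fun A hA => ?_, ?_⟩
  · rcases Multiset.mem_add.1 hA with h | h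
    exacts [h1 A h, h3 A h]
  · have := h2.add h4
    rw [Multiset.map_add, Multiset.sum_add]
    rwa [show Z + W + ((s.map OO).sum + (t.map OO).sum) = Z + (s.map OO).sum + (W + (t.map OO).sum) by abel]

theorem QQ.zero (n : ℕ) (E : Set Γ) : QQ n E 0 := ⟨0, fun A hA => by simp at hA, by simpa using Full.zero n E⟩

theorem QQ.nsmul {n : ℕ} {E : Set Γ} {Z : Multiset Γ} (h : QQ n E Z) (k : ℕ) : QQ n E (k • Z) := by
  induction k with
  | zero => simpa using QQ.zero n E
  | succ k ih => rw [succ_nsmul]; exact ih.add h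

theorem nsmul_eq_OO {n : ℕ} (hΓ : ∀ g : Γ, n • g = 0) (B : Multiset Γ) :
    ∃ m : Multiset Γ, (∀ x ∈ m, x ∈ B) ∧ n • B = (m.map OO).sum := by
  refine ⟨B.bind fun g => Multiset.replicate (n / addOrderOf g) g, ?_, ?_⟩
  · intro x hx
    obtain ⟨g, hg, h⟩ := Multiset.mem_bind.1 hx
    rw [Multiset.eq_of_mem_replicate h]; exact hg
  · rw [← sum_stdFac hΓ, stdFac, Multiset.map_bind]
    simp [OO]

theorem QQ.sub {n : ℕ} (hΓ : ∀ g : Γ, n • g = 0) {E : Set Γ} {Z B : Multiset Γ}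
    (hB : ∀ g ∈ B, g ∈ E) (h : QQ n E (Z + n • B)) : QQ n E Z := by
  obtain ⟨m, h1, h2⟩ := nsmul_eq_OO hΓ B
  obtain ⟨m', h3, h4⟩ := h
  refine ⟨m + m', ?_, ?_⟩
  · intro x hx
    rcases Multiset.mem_add.1 hx with h | h
    exacts [hB x (h1 x h), h3 x h]
  · rwa [Multiset.map_add, Multiset.sum_add, ← h2, ← add_assoc]

theorem full_of_miss {n : ℕ} {E : Finset Γ}
    (hE : ∀ C, IsMinZeroSum (E : Set Γ) C → (∃ g ∈ E, g ∉ C) → wt n C = n)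
    {Z : Multiset Γ} (hZ : IsZeroSumSeq (E : Set Γ) Z) {g : Γ} (hg : g ∈ E) (hgZ : g ∉ Z) :
    Full n E Z := by
  obtain ⟨s, h1, rfl⟩ := exists_fac hZ
  exact ⟨s, h1, fun A hA => hE A (h1 A hA) ⟨g, hg, fun h => hgZ (mem_sum_mem.2 ⟨A, hA, h⟩)⟩, rfl⟩

theorem sum_finset_replicate (F : Finset Γ) (c : Γ → ℕ) :
    (∑ f ∈ F, Multiset.replicate (c f) f).sum = ∑ f ∈ F, c f • f := by
  induction F using Finset.induction_on with
  | empty => simp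
  | insert a s ha ih => rw [Finset.sum_insert ha, Finset.sum_insert ha, Multiset.sum_add, ih]; simp

theorem mem_finset_replicate {F : Finset Γ} {c : Γ → ℕ} {x : Γ}
    (h : x ∈ ∑ f ∈ F, Multiset.replicate (c f) f) : x ∈ F := by
  rw [Multiset.mem_sum] at h
  obtain ⟨f, hf, h⟩ := h
  rw [Multiset.eq_of_mem_replicate h]; exact hf

theorem sum_eq_finset (B : Multiset Γ) {F : Finset Γ} (h : ∀ x ∈ B, x ∈ F) :
    B.sum = ∑ f ∈ F, B.count f • f := by
  rw [Finset.sum_multiset_count]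
  refine Finset.sum_subset (fun x hx => h x (Multiset.mem_toFinset.1 hx)) ?_
  intro x _ hx
  rw [Multiset.count_eq_zero.2 (fun h => hx (Multiset.mem_toFinset.2 h)), zero_smul]

theorem QQ_prime [Finite Γ] {n p a q r : ℕ} (hn0 : 0 < n) (hΓ : ∀ g : Γ, n • g = 0)
    (hn : n = p ^ a * q)
    (hp : p.Prime) (ht : Nat.card {g : Γ // p • g = 0} ≤ p ^ r) {E : Finset Γ}
    (hE : ∀ C, IsMinZeroSum (E : Set Γ) C → (∃ g ∈ E, g ∉ C) → wt n C = n)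
    (hr : r + 2 ≤ E.card) {B : Multiset Γ} (hB : IsZeroSumSeq (E : Set Γ) B) :
    QQ n E (q • B) := by
  have hne : E.Nonempty := Finset.card_pos.1 (by omega)
  obtain ⟨g, hg⟩ := hne
  obtain ⟨F', hF', hc, hcl⟩ := rank_lemma hΓ hn hp ht (E.erase g)
  set B1 := B.filter (fun x => ¬ x = g) with hB1
  have hBeq : B = Multiset.replicate (B.count g) g + B1 := by
    rw [hB1, ← Multiset.filter_eq', Multiset.filter_add_not]
  set b := B.count g with hb
  have hB1F : ∀ x ∈ B1, x ∈ E.erase g := by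
    intro x hx
    rw [hB1, Multiset.mem_filter] at hx
    exact Finset.mem_erase.2 ⟨hx.2, hB.1 x hx.1⟩
  have hx : q • B1.sum ∈ AddSubgroup.closure (F' : Set Γ) := by
    have hle : AddSubgroup.closure ((F'.image fun x => q • x : Finset Γ) : Set Γ) ≤
        AddSubgroup.closure (F' : Set Γ) := by
      rw [AddSubgroup.closure_le]
      intro x hx
      obtain ⟨f, hf, rfl⟩ := Finset.mem_image.1 hx
      exact AddSubgroup.nsmul_mem _ (AddSubgroup.subset_closure hf) _
    apply hle
    rw [sum_eq_finset B1 hB1F, Finset.smul_sum]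
    refine AddSubgroup.sum_mem _ fun f hf => ?_
    rw [smul_comm]
    exact AddSubgroup.nsmul_mem _ (hcl f hf) _
  obtain ⟨c, hcc⟩ := closure_nat hn0 hΓ F' _ hx
  have hsum : (q * b) • g + ∑ f ∈ F', c f • f = 0 := by
    rw [← hcc]
    have := hB.2
    rw [hBeq, Multiset.sum_add, Multiset.sum_replicate] at this
    rw [mul_smul, ← smul_add, this, smul_zero]
  have hgF : g ∉ F' := fun h => by simpa using hF' h
  have hF'E : ∀ x ∈ F', x ∈ E := fun x hx => Finset.mem_of_mem_erase (hF' hx)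
  have hC : Full n E (Multiset.replicate (q * b) g + ∑ f ∈ F', Multiset.replicate (c f) f) := by
    have hcard : (insert g F').card < E.card := by
      have := Finset.card_insert_le g F'
      omega
    obtain ⟨h, hhE, hh⟩ := Finset.exists_mem_notMem_of_card_lt_card hcard
    have hmem : ∀ x ∈ Multiset.replicate (q * b) g + ∑ f ∈ F', Multiset.replicate (c f) f,
        x ∈ insert g F' := by
      intro x hx
      rcases Multiset.mem_add.1 hx with h | h
      · rw [Multiset.eq_of_mem_replicate h]; simp
      · exact Finset.mem_insert_of_mem (mem_finset_replicate h)
    refine full_of_miss hE ⟨fun x hx => ?_, ?_⟩ hhE (fun h' => hh (hmem _ h'))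
    · rcases Finset.mem_insert.1 (hmem x hx) with rfl | h
      exacts [hg, hF'E x h]
    · rw [Multiset.sum_add, sum_finset_replicate, Multiset.sum_replicate, hsum]
  have hY : Full n E (q • B1 + ∑ f ∈ F', Multiset.replicate ((addOrderOf f - 1) * c f) f) := by
    refine full_of_miss hE ⟨fun x hx => ?_, ?_⟩ hg ?_
    · rcases Multiset.mem_add.1 hx with h | h
      · exact Finset.mem_of_mem_erase (hB1F x (Multiset.mem_of_mem_nsmul h))
      · exact hF'E x (mem_finset_replicate h)
    · rw [Multiset.sum_add, sum_finset_replicate, Multiset.sum_nsmul, hcc, ← Finset.sum_add_distrib]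
      refine Finset.sum_eq_zero fun f _ => ?_
      rw [← add_smul]
      have h1 := order_pos hn0 hΓ f
      have : c f + (addOrderOf f - 1) * c f = c f * addOrderOf f := by
        obtain ⟨k, hk⟩ : ∃ k, addOrderOf f = k + 1 := ⟨addOrderOf f - 1, by omega⟩
        rw [hk]; simp; ring
      rw [this, mul_smul, addOrderOf_nsmul_eq_zero, smul_zero]
    · intro h
      rcases Multiset.mem_add.1 h with h | h
      · simpa using hB1F g (Multiset.mem_of_mem_nsmul h)
      · exact hgF (mem_finset_replicate h)
  refine ⟨∑ f ∈ F', Multiset.replicate (c f) f, fun x hx => hF'E x (mem_finset_replicate hx), ?_⟩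
  convert hC.add hY using 1
  have h1 : (Multiset.map OO (∑ f ∈ F', Multiset.replicate (c f) f)).sum =
      ∑ f ∈ F', Multiset.replicate (c f) f + ∑ f ∈ F', Multiset.replicate ((addOrderOf f - 1) * c f) f := by
    rw [← Finset.sum_add_distrib]
    have : ∀ F : Finset Γ, (Multiset.map OO (∑ f ∈ F, Multiset.replicate (c f) f)).sum =
        ∑ f ∈ F, (c f) • OO f := by
      intro F
      induction F using Finset.induction_on with
      | empty => simp
      | insert a s ha ih =>
        rw [Finset.sum_insert ha, Finset.sum_insert ha, Multiset.map_add, Multiset.sum_add, ih]; simp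
    rw [this]
    refine Finset.sum_congr rfl fun f _ => ?_
    rw [← Multiset.replicate_add, OO, Multiset.nsmul_replicate]
    congr 1
    have h1 := order_pos hn0 hΓ f
    obtain ⟨k, hk⟩ : ∃ k, addOrderOf f = k + 1 := ⟨addOrderOf f - 1, by omega⟩
    rw [hk]; simp; ring
  rw [h1]
  conv_lhs => rw [hBeq, nsmul_add, Multiset.nsmul_replicate]
  abel

theorem QQ_all [Finite Γ] {n r : ℕ} (hn0 : 0 < n) (hΓ : ∀ g : Γ, n • g = 0)
    (ht : TorLe Γ r) {E : Finset Γ}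
    (hE : ∀ C, IsMinZeroSum (E : Set Γ) C → (∃ g ∈ E, g ∉ C) → wt n C = n)
    (hr : r + 2 ≤ E.card) {B : Multiset Γ} (hB : IsZeroSumSeq (E : Set Γ) B) :
    QQ n E B := by
  have hnB : QQ n E (n • B) := by
    refine ⟨0, fun A hA => by simp at hA, stdFac n B, fac_stdFac hn0 hΓ hB.1,
      fun A hA => wt_stdFac hΓ hA, by simp [sum_stdFac hΓ]⟩
  have hex : ∃ t, 0 < t ∧ QQ n E (t • B) := ⟨n, hn0, hnB⟩
  set t := Nat.find hex with htdef
  obtain ⟨ht0, htQ⟩ := Nat.find_spec hex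
  rw [← htdef] at ht0 htQ
  have hsub : ∀ k z : ℕ, QQ n E ((z + k * n) • B) → QQ n E (z • B) := by
    intro k
    induction k with
    | zero => intro z h; simpa using h
    | succ k ih =>
      intro z h
      apply ih
      apply QQ.sub hΓ hB.1
      rwa [← add_smul, show z + k * n + n = z + (k + 1) * n by ring]
  have hdvd : ∀ z, QQ n E (z • B) → t ∣ z := by
    intro z hz
    by_contra hnd
    have h1 : 0 < z % t := Nat.pos_of_ne_zero fun h => hnd (Nat.dvd_of_mod_eq_zero h)
    refine Nat.find_min hex (Nat.mod_lt z ht0) ⟨h1, ?_⟩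
    apply hsub (z / t * t)
    have h2 := hz.add (htQ.nsmul (z / t * (n - 1)))
    rw [← mul_smul, ← add_smul] at h2
    have h3 : z % t + z / t * t * n = z + z / t * (n - 1) * t := by
      have := Nat.mod_add_div z t
      obtain ⟨k, rfl⟩ : ∃ k, n = k + 1 := ⟨n - 1, by omega⟩
      simp only [Nat.add_sub_cancel]
      nlinarith
    rwa [h3]
  have ht1 : t = 1 := by
    by_contra hne
    have hp := Nat.minFac_prime hne
    obtain ⟨a, q, hq, hnq⟩ := Nat.exists_eq_pow_mul_and_not_dvd hn0.ne' t.minFac hp.ne_one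
    have := hdvd q (QQ_prime hn0 hΓ hnq hp (ht _ hp) hE hr hB)
    exact hq ((Nat.minFac_dvd t).trans this)
  rw [ht1, one_smul] at htQ
  exact htQ

theorem wt_OO_sum {n : ℕ} (hΓ : ∀ g : Γ, n • g = 0) (m : Multiset Γ) :
    wt n (m.map OO).sum = n * Multiset.card m := by
  rw [wt_sum_eq (a := n)]
  · simp [mul_comm]
  · intro A hA
    obtain ⟨x, _, rfl⟩ := Multiset.mem_map.1 hA
    exact wt_order hΓ x

theorem fac_OO {n : ℕ} (hn0 : 0 < n) (hΓ : ∀ g : Γ, n • g = 0) {E : Set Γ} {m : Multiset Γ}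
    (hm : ∀ x ∈ m, x ∈ E) : Fac E (m.map OO) := by
  intro A hA
  obtain ⟨x, hx, rfl⟩ := Multiset.mem_map.1 hA
  exact atom_replicate (hm x hx) (order_pos hn0 hΓ x)

theorem QQ_conseq {n d : ℕ} (hn0 : 0 < n) (hΓ : ∀ g : Γ, n • g = 0) {E : Set Γ}
    (hd : DvdD d E) {s : Multiset (Multiset Γ)} (hs : Fac E s) (hQ : QQ n E s.sum) :
    ∃ w : ℕ, wt n s.sum = w * n ∧ (d : ℤ) ∣ (Multiset.card s : ℤ) - w := by
  obtain ⟨m, hm, u, hu, hu2, hu3⟩ := hQ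
  have h1 := congrArg (wt n) hu3
  rw [wt_sum_eq hu2, wt_add, wt_OO_sum hΓ] at h1
  have h2 := hd (s + m.map OO) u (hs.add (fac_OO hn0 hΓ hm)) hu (by rw [hu3]; simp)
  have h3 : Multiset.card m ≤ Multiset.card u := by
    by_contra h
    have : Multiset.card u * n < n * Multiset.card m := by
      rw [mul_comm]; exact Nat.mul_lt_mul_of_pos_left (by omega) hn0
    omega
  obtain ⟨w, hw⟩ := Nat.exists_eq_add_of_le h3
  refine ⟨w, ?_, ?_⟩
  · rw [hw] at h1; ring_nf at h1 ⊢; linarith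
  · rw [hw] at h2
    convert h2 using 1
    simp
    ring

theorem full_of_wt {n : ℕ} {E : Set Γ} {s : Multiset (Multiset Γ)} (hs : Fac E s)
    (hge : ∀ A ∈ s, n ≤ wt n A) (h : wt n s.sum = Multiset.card s * n) : Full n E s.sum := by
  refine ⟨s, hs, fun A hA => ?_, rfl⟩
  obtain ⟨t, rfl⟩ := Multiset.exists_cons_of_mem hA
  rw [Multiset.sum_cons, wt_add, Multiset.card_cons] at h
  have h1 := hge A hA
  have h2 : Multiset.card t * n ≤ wt n t.sum := le_wt_sum fun B hB => hge B (by simp [hB])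
  rw [add_mul] at h
  omega

theorem step3_aux {n : ℕ} {E : Set Γ} (m : Multiset Γ) (hm : ∀ x ∈ m, x ∈ E) :
    ∀ B, IsZeroSumSeq E B → ¬ Full n E B → Full n E (B + (m.map OO).sum) →
      ∃ B x, IsZeroSumSeq E B ∧ x ∈ E ∧ ¬ Full n E B ∧ Full n E (B + OO x) := by
  induction m using Multiset.induction_on with
  | empty => intro B _ h h'; simp at h'; exact absurd h' h
  | cons x m ih =>
    intro B h0 h h'
    by_cases hf : Full n E (B + OO x)
    · exact ⟨B, x, h0, hm x (by simp), h, hf⟩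
    · refine ih (fun y hy => hm y (by simp [hy])) (B + OO x) ⟨?_, ?_⟩ hf ?_
      · intro g hg
        rcases Multiset.mem_add.1 hg with h | h
        · exact h0.1 g h
        · rw [OO] at h; rw [Multiset.eq_of_mem_replicate h]; exact hm x (by simp)
      · rw [Multiset.sum_add, h0.2, OO, sum_replicate_order, add_zero]
      · simpa [add_assoc] using h'

theorem count_sum_ge {x : Γ} {t : Multiset (Multiset Γ)} {k : ℕ}
    (h : ∀ U ∈ t, k ≤ U.count x) : k * Multiset.card t ≤ t.sum.count x := by
  induction t using Multiset.induction_on with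
  | empty => simp
  | cons a s ih =>
    have h1 := h a (by simp)
    have h2 := ih fun U hU => h U (by simp [hU])
    rw [Multiset.sum_cons, Multiset.count_add, Multiset.card_cons, mul_add]; omega

theorem step3 [Finite Γ] {n r d : ℕ} (hn0 : 0 < n) (hΓ : ∀ g : Γ, n • g = 0)
    (ht : TorLe Γ r) (hnd : n ≤ 2 * d + 2) {E : Finset Γ}
    (hd : DvdD d (E : Set Γ))
    (hge : ∀ C, IsMinZeroSum (E : Set Γ) C → n ≤ wt n C)
    (hE : ∀ C, IsMinZeroSum (E : Set Γ) C → (∃ g ∈ E, g ∉ C) → wt n C = n)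
    (hr : r + 2 ≤ E.card) {A : Multiset Γ} (hA : IsMinZeroSum (E : Set Γ) A) : wt n A = n := by
  by_contra hwt
  have hnf : ¬ Full n (E : Set Γ) A := by
    rintro ⟨s, h1, h2, h3⟩
    have hs0 : s ≠ 0 := by rintro rfl; exact hA.1 (by simpa using h3.symm)
    obtain ⟨U, hU⟩ := Multiset.exists_mem_of_ne_zero hs0
    have hle : U ≤ A := by
      rw [← h3]; exact Multiset.single_le_sum (fun _ _ => by simp) U hU
    rcases hA.2.2.2 U hle (h1 U hU).2.2.1 with h | h
    · exact (h1 U hU).1 h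
    · exact hwt (h ▸ h2 U hU)
  have hQ : ∀ B, IsZeroSumSeq (E : Set Γ) B → QQ n (E : Set Γ) B := fun B hB =>
    QQ_all hn0 hΓ ht hE hr hB
  obtain ⟨m, hm, hm2⟩ := hQ A ⟨hA.2.1, hA.2.2.1⟩
  obtain ⟨B, x, hB, hx, hBf, s, hs, hsw, hsum⟩ := step3_aux m hm A ⟨hA.2.1, hA.2.2.1⟩ hnf hm2
  have hex : ∃ k, ∃ t ≤ s, Multiset.card t = k ∧ addOrderOf x ≤ t.sum.count x :=
    ⟨_, s, le_rfl, rfl, by rw [hsum, OO]; simp⟩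
  obtain ⟨t, hts, htc, hto⟩ := Nat.find_spec hex
  have hmin := fun k (hk : k < Nat.find hex) => Nat.find_min hex hk
  have hOle : OO x ≤ t.sum := Multiset.le_count_iff_replicate_le.1 hto
  set R := t.sum - OO x with hR
  have hRt : R + OO x = t.sum := Multiset.sub_add_cancel hOle
  have hBeq : B = R + (s - t).sum := by
    have : s = t + (s - t) := (add_tsub_cancel_of_le hts).symm
    have h2 : s.sum = t.sum + (s - t).sum := by
      conv_lhs => rw [this]
      rw [Multiset.sum_add]
    rw [h2, ← hRt] at hsum
    have h3 : OO x + (R + (s - t).sum) = OO x + B := by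
      rw [add_comm _ B, ← hsum]; abel
    exact (add_left_cancel h3).symm
  have hst : Full n (E : Set Γ) (s - t).sum :=
    ⟨s - t, hs.le (Multiset.sub_le_self _ _), fun A hA => hsw A (Multiset.mem_of_le (Multiset.sub_le_self _ _) hA), rfl⟩
  have hRf : ¬ Full n (E : Set Γ) R := fun h => hBf (hBeq ▸ h.add hst)
  have hRz : IsZeroSumSeq (E : Set Γ) R := by
    refine ⟨fun g hg => hB.1 g (by rw [hBeq]; simp [hg]), ?_⟩
    have := congrArg Multiset.sum hRt
    rw [Multiset.sum_add, (hs.le hts).sum_sum, OO, sum_replicate_order, add_zero] at this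
    exact this
  obtain ⟨u, hu, huR⟩ := exists_fac hRz
  obtain ⟨w, hw, hwd⟩ := QQ_conseq hn0 hΓ hd hu (by rw [huR]; exact hQ R hRz)
  have hu0 : u ≠ 0 := by
    rintro rfl
    apply hRf
    rw [← huR]; exact Full.zero _ _
  have hu1 : 1 ≤ Multiset.card u := Multiset.card_pos.2 hu0
  have huge : ∀ A ∈ u, n ≤ wt n A := fun A hA => hge A (hu A hA)
  have h1 := le_wt_sum huge
  have hlt : Multiset.card u < w := by
    have hle : Multiset.card u ≤ w := by
      rw [hw] at h1
      exact Nat.le_of_mul_le_mul_right h1 hn0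
    refine lt_of_le_of_ne hle fun h => hRf ?_
    rw [← huR]
    exact full_of_wt hu huge (by rw [hw, h])
  have hwd2 : Multiset.card u + d ≤ w := by
    have h2 : (d : ℤ) ∣ (w : ℤ) - Multiset.card u := by
      rw [← dvd_neg, neg_sub]; exact hwd
    have := Int.le_of_dvd (by omega) h2
    omega
  have htw : w + 1 = Multiset.card t := by
    have h2 := congrArg (wt n) hRt
    rw [wt_add, wt_sum_eq (fun A hA => hsw A (Multiset.mem_of_le hts hA)), OO, wt_order hΓ, ← huR, hw] at h2
    have : (w + 1) * n = Multiset.card t * n := by rw [← h2]; ring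
    exact Nat.eq_of_mul_eq_mul_right hn0 this
  have hcx : 1 ≤ R.count x := by
    rw [Multiset.one_le_count_iff_mem]
    by_contra h
    exact hRf (full_of_miss hE hRz hx h)
  have htx : t.sum.count x = R.count x + addOrderOf x := by
    rw [← hRt, OO]; simp
  have herase : ∀ U ∈ t, (t.erase U).sum.count x + 1 ≤ addOrderOf x ∧
      (t.erase U).sum.count x + U.count x = t.sum.count x := by
    intro U hU
    constructor
    · by_contra h
      refine hmin (Multiset.card (t.erase U)) ?_ ⟨t.erase U, (Multiset.erase_le _ _).trans hts, rfl, by omega⟩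
      rw [← htc]; exact Multiset.card_erase_lt_of_mem hU
    · conv_rhs => rw [← Multiset.cons_erase hU]
      rw [Multiset.sum_cons, Multiset.count_add]; omega
  have h2 : ∀ U ∈ t, 2 ≤ U.count x := by
    intro U hU
    have := herase U hU
    omega
  have ht0 : t ≠ 0 := by
    rintro rfl; simp at htw
  obtain ⟨U, hU⟩ := Multiset.exists_mem_of_ne_zero ht0
  have h3 := count_sum_ge (x := x) (t := t.erase U) (k := 2) fun V hV => h2 V (Multiset.mem_of_mem_erase hV)
  have h4 := (herase U hU).1
  have h5 := order_le hn0 hΓ x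
  rw [Multiset.card_erase_of_mem hU] at h3
  simp only [Nat.pred_eq_sub_one] at h3
  omega

theorem step1 {n r d : ℕ} (hn0 : 0 < n) (hΓ : ∀ g : Γ, n • g = 0) (hrd : r ≤ d)
    {E : Finset Γ} (hd : DvdD d (E : Set Γ))
    (hge : ∀ C, IsMinZeroSum (E : Set Γ) C → n ≤ wt n C)
    (hr : E.card ≤ r + 1) {A : Multiset Γ} (hA : IsMinZeroSum (E : Set Γ) A) : wt n A = n := by
  by_contra hwt
  have hgt : n < wt n A := lt_of_le_of_ne (hge A hA) (Ne.symm hwt)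
  set P := (E.val.map OO).sum with hP
  have hcount : ∀ g ∈ E, P.count g = addOrderOf g := by
    intro g hg
    have h1 : E.val = g ::ₘ (E.erase g).val := by
      rw [Finset.erase_val, Multiset.cons_erase hg]
    rw [hP, h1, Multiset.map_cons, Multiset.sum_cons, Multiset.count_add, OO, Multiset.count_replicate_self]
    rw [Multiset.count_eq_zero.2, add_zero]
    intro h
    obtain ⟨C, hC, h⟩ := mem_sum_mem.1 h
    obtain ⟨x, hx, rfl⟩ := Multiset.mem_map.1 hC
    rw [OO] at h
    have := Multiset.eq_of_mem_replicate h
    subst this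
    exact Finset.notMem_erase g E hx
  have hAP : A ≤ P := by
    rw [Multiset.le_iff_count]
    intro g
    by_cases hg : g ∈ A
    · rw [hcount g (hA.2.1 g hg)]; exact atom_count_le hA (order_pos hn0 hΓ g)
    · rw [Multiset.count_eq_zero.2 hg]; omega
  have hfP : Fac (E : Set Γ) (E.val.map OO) := fac_OO hn0 hΓ fun x hx => hx
  have hD : IsZeroSumSeq (E : Set Γ) (P - A) := by
    refine ⟨fun g hg => hfP.mem g (Multiset.mem_of_le (Multiset.sub_le_self _ _) hg), ?_⟩
    rw [sum_sub_eq hAP, hA.2.2.1, hP, hfP.sum_sum, sub_zero]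
  obtain ⟨u, hu, hu2⟩ := exists_fac hD
  have hu0 : u ≠ 0 := by
    rintro rfl
    rw [Multiset.sum_zero] at hu2
    have hPA : A = P := le_antisymm hAP (by simpa using tsub_eq_zero_iff_le.1 hu2.symm)
    obtain ⟨g, hg⟩ := Multiset.exists_mem_of_ne_zero hA.1
    have h1 := atom_eq_of_order_le hA (order_pos hn0 hΓ g) (by rw [hPA, hcount g (hA.2.1 g hg)])
    rw [h1, wt_order hΓ] at hgt
    omega
  have hu1 : 1 ≤ Multiset.card u := Multiset.card_pos.2 hu0
  have h1 := hd (E.val.map OO) (A ::ₘ u) hfP (by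
    intro C hC
    rcases Multiset.mem_cons.1 hC with rfl | h
    exacts [hA, hu C h]) (by rw [Multiset.sum_cons, hu2, add_comm, Multiset.sub_add_cancel hAP])
  have h2 : Multiset.card u * n ≤ wt n u.sum := le_wt_sum fun A hA => hge A (hu A hA)
  have h3 : wt n u.sum + wt n A = n * E.card := by
    rw [hu2, wt_sub hAP, hP, wt_OO_sum hΓ]; rfl
  have h4 : Multiset.card u + 1 < E.card := by
    by_contra h
    have : n * E.card ≤ n * (Multiset.card u + 1) := Nat.mul_le_mul_left _ (by omega)
    rw [mul_add, mul_comm] at this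
    rw [mul_comm n (Multiset.card u)] at this
    rw [mul_comm] at h3
    omega
  rw [Multiset.card_map, Multiset.card_cons] at h1
  have := Int.le_of_dvd (by simp; omega) h1
  simp at this
  omega

theorem T1 [Finite Γ] {n r d : ℕ} (hn0 : 0 < n) (hΓ : ∀ g : Γ, n • g = 0)
    (ht : TorLe Γ r) (hrd : r ≤ d) (hnd : n ≤ 2 * d + 2) {G0 : Set Γ}
    (hd : DvdD d G0) (hge : ∀ C, IsMinZeroSum G0 C → n ≤ wt n C)
    {A : Multiset Γ} (hA : IsMinZeroSum G0 A) : wt n A = n := by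
  induction hk : A.toFinset.card using Nat.strong_induction_on generalizing A with
  | _ k ih =>
    have hEG : ((A.toFinset : Finset Γ) : Set Γ) ⊆ G0 := fun g hg =>
      hA.2.1 g (by simpa using hg)
    have hA' : IsMinZeroSum ((A.toFinset : Finset Γ) : Set Γ) A :=
      IsMinZeroSum.mono' hA fun g hg => by simpa using hg
    have hge' : ∀ C, IsMinZeroSum ((A.toFinset : Finset Γ) : Set Γ) C → n ≤ wt n C := fun C hC =>
      hge C (IsMinZeroSum.mono hC hEG)
    by_cases hr : A.toFinset.card ≤ r + 1
    · exact step1 hn0 hΓ hrd (hd.mono hEG) hge' hr hA'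
    · refine step3 hn0 hΓ ht hnd (hd.mono hEG) hge' ?_ (by omega) hA'
      rintro C hC ⟨g, hg, hgC⟩
      refine ih _ ?_ (IsMinZeroSum.mono hC hEG) rfl
      rw [← hk]
      refine Finset.card_lt_card ⟨fun x hx => ?_, fun h => ?_⟩
      · exact hC.2.1 x (by simpa using hx)
      · exact hgC (by simpa using h hg)

theorem wt_small [Finite Γ] {n d : ℕ} (hn0 : 0 < n) (hΓ : ∀ g : Γ, n • g = 0)
    (hnd : n ≤ 2 * d + 1) {G0 : Set Γ}
    (hd : DvdD d G0) {A : Multiset Γ} (hA : IsMinZeroSum G0 A) (hlt : wt n A < n) :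
    wt n A + d = n := by
  have h1 := dvd_wt hn0 hΓ hd hA
  obtain ⟨k, hk⟩ := h1
  have hw2 : 2 ≤ wt n A := by
    by_contra h
    have hc := card_le_wt hn0 hΓ A
    have hp : 1 ≤ Multiset.card A := Multiset.card_pos.2 hA.1
    obtain ⟨g, rfl⟩ := Multiset.card_eq_one.1 (show Multiset.card A = 1 by omega)
    have hg : g = 0 := by simpa using hA.2.2.1
    subst hg
    simp [wt] at hlt
  have hk1 : 0 < k := by
    by_contra h
    have : (d : ℤ) * k ≤ 0 := mul_nonpos_of_nonneg_of_nonpos (by positivity) (by omega)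
    omega
  have hk2 : k < 2 := by
    by_contra h
    have : (d : ℤ) * 2 ≤ d * k := mul_le_mul_of_nonneg_left (by omega) (by positivity)
    omega
  have : k = 1 := by omega
  subst this
  omega

theorem T2small [Finite Γ] {n d : ℕ} (hn0 : 0 < n) (hΓ : ∀ g : Γ, n • g = 0)
    (hnd : n ≤ 2 * d + 1) {G0 : Set Γ}
    (hd : DvdD d G0) {A : Multiset Γ} (hA : IsMinZeroSum G0 A) (hlt : wt n A < n) :
    ∀ g ∈ A, A.count g = 1 ∧ addOrderOf g = n := by
  intro g hg
  by_contra hcon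
  have hv : 1 ≤ A.count g := Multiset.one_le_count_iff_mem.2 hg
  set v := A.count g with hvdef
  have ho := order_pos hn0 hΓ g
  have hon := order_le hn0 hΓ g
  set o := addOrderOf g with hodef
  obtain ⟨i, hi⟩ : ∃ i, i = (o - 1) / v := ⟨_, rfl⟩
  have hi1 : i * v ≤ o - 1 := by rw [hi]; exact Nat.div_mul_le_self _ _
  have hi2 : o ≤ (i + 1) * v := by
    have := Nat.lt_div_mul_add (a := o - 1) (b := v) (by omega)
    rw [← hi] at this
    rw [add_mul]; omega
  have hi3 : 2 * (i + 1) ≤ n + 1 := by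
    by_cases h2 : 2 ≤ v
    · have : i * 2 ≤ i * v := Nat.mul_le_mul_left _ h2
      omega
    · have hv1 : v = 1 := by omega
      have hne : o ≠ n := fun h => hcon ⟨hv1, h⟩
      obtain ⟨k, hk⟩ := order_dvd hΓ g
      rw [← hodef] at hk
      have hk2 : 2 ≤ k := by
        by_contra h
        have : k = 0 ∨ k = 1 := by omega
        rcases this with rfl | rfl <;> omega
      have : o * 2 ≤ o * k := Nat.mul_le_mul_left _ hk2
      rw [hv1] at hi1
      omega
  have hle : OO g ≤ (i + 1) • A := by
    rw [OO]
    apply Multiset.le_count_iff_replicate_le.1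
    rw [Multiset.count_nsmul]
    exact hi2
  have hmem : ∀ x ∈ (i + 1) • A - OO g, x ∈ G0 := fun x hx =>
    hA.2.1 x (Multiset.mem_of_mem_nsmul (Multiset.mem_of_le (Multiset.sub_le_self _ _) hx))
  obtain ⟨u, hu, hu2⟩ := exists_fac (G0 := G0) (B := (i + 1) • A - OO g) ⟨hmem, by
    rw [sum_sub_eq hle, Multiset.sum_nsmul, hA.2.2.1, OO, sum_replicate_order]; simp⟩
  have hwA := wt_small hn0 hΓ hnd hd hA hlt
  have hu0 : u ≠ 0 := by
    rintro rfl
    rw [Multiset.sum_zero] at hu2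
    have h1 : (i + 1) • A ≤ OO g := tsub_eq_zero_iff_le.1 hu2.symm
    have h2 : A ≤ OO g := le_trans (by rw [succ_nsmul]; exact Multiset.le_add_left _ _) h1
    obtain ⟨k, hk, hk2⟩ := Multiset.le_replicate_iff.1 h2
    have h3 := hA.2.2.1
    rw [hk2, Multiset.sum_replicate] at h3
    obtain ⟨m, rfl⟩ := addOrderOf_dvd_of_nsmul_eq_zero h3
    rw [hk2, wt_replicate] at hlt
    have hm : 1 ≤ m := by
      rcases Nat.eq_zero_or_pos m with rfl | h
      · exfalso; apply hA.1; rw [hk2]; simp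
      · exact h
    have h4 : addOrderOf g * m * (n / addOrderOf g) = m * n := by
      calc addOrderOf g * m * (n / addOrderOf g) = m * (addOrderOf g * (n / addOrderOf g)) := by ring
        _ = m * n := by rw [Nat.mul_div_cancel' (order_dvd hΓ g)]
    rw [h4] at hlt
    nlinarith
  have hu1 : 1 ≤ Multiset.card u := Multiset.card_pos.2 hu0
  have huw : ∀ C ∈ u, wt n A ≤ wt n C := by
    intro C hC
    by_cases h : wt n C < n
    · have := wt_small hn0 hΓ hnd hd (hu C hC) h
      omega
    · omega
  have h1 := le_wt_sum huw
  have h2 : wt n u.sum + n = (i + 1) * wt n A := by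
    have := wt_sub (n := n) hle
    rw [wt_nsmul, ← hu2, OO, wt_order hΓ] at this
    exact this
  have h3 : Multiset.card u < i := by
    by_contra h
    have : i * wt n A ≤ Multiset.card u * wt n A := Nat.mul_le_mul_right _ (by omega)
    rw [add_mul] at h2
    omega
  have h4 := hd (Multiset.replicate (i + 1) A) (OO g ::ₘ u) (Fac.replicate hA _) (by
    intro C hC
    rcases Multiset.mem_cons.1 hC with rfl | h
    exacts [atom_replicate (hA.2.1 g hg) ho, hu C h]) (by
      rw [Multiset.sum_cons, hu2, add_comm (OO g), Multiset.sub_add_cancel hle, Multiset.sum_replicate])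
  rw [Multiset.card_replicate, Multiset.card_cons] at h4
  have := Int.le_of_dvd (by push_cast; omega) h4
  push_cast at this
  omega

theorem T2 [Finite Γ] {n r d : ℕ} (hn0 : 0 < n) (hΓ : ∀ g : Γ, n • g = 0)
    (ht : TorLe Γ r) (hrd : r ≤ d) (hnd : n ≤ 2 * d + 1) {G0 : Set Γ}
    (hd : DvdD d G0) {A : Multiset Γ} (hA : IsMinZeroSum G0 A) :
    wt n A = n ∨ (wt n A + d = n ∧ A.Nodup ∧ ∀ g ∈ A, addOrderOf g = n) := by
  have key : ∀ {A : Multiset Γ}, IsMinZeroSum G0 A → wt n A < n → A.Nodup := by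
    intro A hA hlt
    rw [Multiset.nodup_iff_count_le_one]
    intro g
    by_cases hg : g ∈ A
    · exact (T2small hn0 hΓ hnd hd hA hlt g hg).1.le
    · rw [Multiset.count_eq_zero.2 hg]; omega
  rcases lt_trichotomy (wt n A) n with hlt | heq | hgt
  · exact Or.inr ⟨wt_small hn0 hΓ hnd hd hA hlt, key hA hlt,
      fun g hg => (T2small hn0 hΓ hnd hd hA hlt g hg).2⟩
  · exact Or.inl heq
  · left
    have hsub : {g | g ∈ A} ⊆ G0 := fun g hg => hA.2.1 g hg
    refine T1 (G0 := {g | g ∈ A}) hn0 hΓ ht hrd (by omega) (hd.mono hsub) ?_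
      (IsMinZeroSum.mono' hA fun g hg => hg)
    intro C hC
    by_contra h
    have hCn := key (IsMinZeroSum.mono hC hsub) (by omega)
    have hCA : C ≤ A := (Multiset.le_iff_subset hCn).2 fun g hg => hC.2.1 g hg
    rcases hA.2.2.2 C hCA hC.2.2.1 with h1 | h1
    · exact hC.1 h1
    · rw [h1] at h; omega

theorem exists_hom {n : ℕ} [NeZero n] (hΓ : ∀ g : Γ, n • g = 0) {r : ℕ} (e : Fin r → Γ) :
    ∃ φ : (Fin r → ZMod n) →+ Γ, ∀ x, φ x = ∑ i, (x i).val • e i := by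
  letI : Module (ZMod n) Γ := AddCommGroup.zmodModule hΓ
  refine ⟨(Fintype.linearCombination (ZMod n) e).toAddMonoidHom, fun x => ?_⟩
  simp only [LinearMap.toAddMonoidHom_coe, Fintype.linearCombination_apply]
  refine Finset.sum_congr rfl fun i _ => ?_
  rw [← Nat.cast_smul_eq_nsmul (ZMod n), ZMod.natCast_zmod_val]

theorem T3 [Finite Γ] {n r d : ℕ} (hn0 : 0 < n) (hΓ : ∀ g : Γ, n • g = 0)
    (ht : TorLe Γ d) (hnd : n ≤ 2 * d + 1) (hd0 : 1 ≤ d) (hdr : d + r + 1 = n) {G0 : Set Γ}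
    (hd : DvdD d G0) {A : Multiset Γ} (hA : IsMinZeroSum G0 A) (hwA : wt n A ≠ n) :
    ∃ φ : (Fin r → ZMod n) →+ Γ, Function.Injective φ := by
  haveI : NeZero n := ⟨hn0.ne'⟩
  obtain ⟨hw, hnodup, hord⟩ := (T2 hn0 hΓ ht le_rfl hnd hd hA).resolve_left hwA
  have hcard : Multiset.card A = r + 1 := by
    have : wt n A = Multiset.card A := by
      rw [wt, Multiset.map_congr rfl (g := fun _ => 1)]
      · simp
      · intro g hg
        rw [hord g hg, Nat.div_self hn0]
    omega
  obtain ⟨g0, hg0⟩ := Multiset.exists_mem_of_ne_zero hA.1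
  set E' := A.toFinset.erase g0 with hE'
  have hE'A : ∀ f ∈ E', f ∈ A := fun f hf => by
    simpa using Finset.mem_of_mem_erase hf
  have hE'c : E'.card = r := by
    rw [hE', Finset.card_erase_of_mem (by simpa using hg0), Multiset.toFinset_card_of_nodup hnodup, hcard]
    rfl
  have key : ∀ {C : Multiset Γ}, IsMinZeroSum G0 C → ∀ g ∈ A, (∀ x ∈ C, x ∈ A) → g ∉ C → wt n C = n := by
    intro C hC g hgA hCA hgC
    rcases T2 hn0 hΓ ht le_rfl hnd hd hC with h | ⟨_, h, _⟩
    · exact h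
    · exfalso
      rcases hA.2.2.2 C ((Multiset.le_iff_subset h).2 hCA) hC.2.2.1 with h1 | h1
      · exact hC.1 h1
      · exact hgC (h1 ▸ hgA)
  have indep : ∀ a : Γ → ℕ, (∀ f, a f < n) → ∑ f ∈ E', a f • f = 0 → ∀ f ∈ E', a f = 0 := by
    intro a ha hsum f hf
    by_contra haf
    set B := ∑ f ∈ E', Multiset.replicate (a f) f with hB
    have hBcount : ∀ x, B.count x ≤ a x := by
      intro x
      rw [hB, Multiset.count_sum']
      simp only [Multiset.count_replicate]
      by_cases hx : x ∈ E'
      · rw [Finset.sum_ite_eq' E' x]; simp [hx]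
      · rw [Finset.sum_ite_eq' E' x]; simp [hx]
    have hBm : ∀ x ∈ B, x ∈ E' := fun x hx => mem_finset_replicate hx
    have hB0 : B ≠ 0 := by
      intro h
      have : f ∈ B := by
        rw [hB, Multiset.mem_sum]
        exact ⟨f, hf, Multiset.mem_replicate.2 ⟨haf, rfl⟩⟩
      rw [h] at this
      simp at this
    obtain ⟨C, hCB, hC⟩ := exists_atom_le (G0 := G0) (B := B) ⟨fun x hx => hA.2.1 x (hE'A x (hBm x hx)), by
      rw [hB, sum_finset_replicate, hsum]⟩ hB0
    have hCm : ∀ x ∈ C, x ∈ E' := fun x hx => hBm x (Multiset.mem_of_le hCB hx)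
    have hCn : wt n C = n := by
      refine key hC g0 hg0 (fun x hx => hE'A x (hCm x hx)) fun h => ?_
      simpa [hE'] using hCm g0 h
    obtain ⟨g1, hg1, hmax⟩ := Finset.exists_max_image C.toFinset (fun x => C.count x) (by
      obtain ⟨x, hx⟩ := Multiset.exists_mem_of_ne_zero hC.1
      exact ⟨x, by simpa using hx⟩)
    have hg1C : g1 ∈ C := by simpa using hg1
    set c := C.count g1 with hc
    have hc1 : 1 ≤ c := Multiset.one_le_count_iff_mem.2 hg1C
    have hcn : c < n := lt_of_le_of_lt ((Multiset.le_iff_count.1 hCB g1).trans (hBcount g1)) (ha g1)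
    have hg1A : g1 ∈ A := hE'A g1 (hCm g1 hg1C)
    have hcA : ∀ x ∈ A, A.count x = 1 := fun x hx => Multiset.count_eq_one_of_mem hnodup hx
    have hCle : C ≤ c • A := by
      rw [Multiset.le_iff_count]
      intro x
      by_cases hx : x ∈ C
      · rw [Multiset.count_nsmul, hcA x (hE'A x (hCm x hx)), mul_one]
        exact hmax x (by simpa using hx)
      · rw [Multiset.count_eq_zero.2 hx]; omega
    have hWm : ∀ x ∈ c • A - C, x ∈ A := fun x hx =>
      Multiset.mem_of_mem_nsmul (Multiset.mem_of_le (Multiset.sub_le_self _ _) hx)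
    obtain ⟨u, hu, hu2⟩ := exists_fac (G0 := G0) (B := c • A - C) ⟨fun x hx => hA.2.1 x (hWm x hx), by
      rw [sum_sub_eq hCle, Multiset.sum_nsmul, hA.2.2.1, hC.2.2.1]; simp⟩
    have hg1W : g1 ∉ c • A - C := by
      rw [← Multiset.count_eq_zero, Multiset.count_sub, Multiset.count_nsmul, hcA g1 hg1A]
      omega
    have huw : ∀ U ∈ u, wt n U = n := by
      intro U hU
      have hUle : ∀ x ∈ U, x ∈ c • A - C := fun x hx => by
        rw [← hu2]; exact mem_sum_mem.2 ⟨U, hU, hx⟩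
      exact key (hu U hU) g1 hg1A (fun x hx => hWm x (hUle x hx)) fun h => hg1W (hUle g1 h)
    have h1 := wt_sub (n := n) hCle
    rw [← hu2, wt_sum_eq huw, wt_nsmul, hCn] at h1
    have h2 := hd (Multiset.replicate c A) (C ::ₘ u) (Fac.replicate hA _) (by
      intro D hD
      rcases Multiset.mem_cons.1 hD with rfl | h
      exacts [hC, hu D h]) (by
        rw [Multiset.sum_cons, hu2, add_comm, Multiset.sub_add_cancel hCle, Multiset.sum_replicate])
    rw [Multiset.card_replicate, Multiset.card_cons] at h2
    obtain ⟨m, hm⟩ := h2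
    have h3 : (c : ℤ) = n * m := by
      have hw' : (wt n A : ℤ) = n - d := by omega
      have h1' : (Multiset.card u : ℤ) * n + n = c * (n - d) := by rw [← hw']; exact_mod_cast h1
      push_cast at hm
      have : (d : ℤ) * c = d * (n * m) := by
        linear_combination h1' + (n : ℤ) * hm
      exact mul_left_cancel₀ (by omega) this
    have hm0 : 0 < m := by
      by_contra h
      have : (n : ℤ) * m ≤ 0 := mul_nonpos_of_nonneg_of_nonpos (by positivity) (by omega)
      omega
    have : (n : ℤ) * 1 ≤ n * m := mul_le_mul_of_nonneg_left (by omega) (by positivity)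
    omega
  let e := (E'.equivFinOfCardEq hE'c).symm
  obtain ⟨φ, hφ⟩ := exists_hom hΓ (fun i => ((e i : E') : Γ))
  refine ⟨φ, (injective_iff_map_eq_zero φ).2 fun x hx => ?_⟩
  rw [hφ] at hx
  have h1 := indep (fun f => if hf : f ∈ E' then (x (e.symm ⟨f, hf⟩)).val else 0) (fun f => by
      split
      · exact ZMod.val_lt _
      · exact hn0) (by
      rw [← hx, ← Finset.sum_coe_sort, ← e.sum_comp]
      refine Finset.sum_congr rfl fun i _ => ?_
      simp)
  funext i
  have h2 := h1 (e i) (e i).2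
  simp at h2
  exact h2

theorem atom_card_le [Fintype Γ] {n : ℕ} (hn0 : 0 < n) (hΓ : ∀ g : Γ, n • g = 0)
    {G0 : Set Γ} {A : Multiset Γ} (hA : IsMinZeroSum G0 A) :
    Multiset.card A ≤ Fintype.card Γ * n := by
  rw [← Multiset.sum_count_eq_card (s := Finset.univ) (fun a _ => Finset.mem_univ a)]
  have := Finset.sum_le_card_nsmul (Finset.univ : Finset Γ) (fun g => A.count g) n fun g _ =>
    (atom_count_le hA (order_pos hn0 hΓ g)).trans (order_le hn0 hΓ g)
  simpa using this

theorem bad_card [Fintype Γ] (G0 : Set Γ) (s : Multiset (Multiset Γ)) :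
    Multiset.card (s.filter fun A => ¬ ∀ g ∈ A, g ∈ G0) ≤
      ∑ g ∈ Finset.univ.filter (fun g => g ∉ G0), s.sum.count g := by
  induction s using Multiset.induction_on with
  | empty => simp
  | cons a s ih =>
    simp only [Multiset.sum_cons, Multiset.count_add, Finset.sum_add_distrib]
    by_cases h : ∀ g ∈ a, g ∈ G0
    · rw [Multiset.filter_cons_of_neg _ (by simpa using h)]
      omega
    · rw [Multiset.filter_cons_of_pos (p := fun A : Multiset Γ => ¬ ∀ g ∈ A, g ∈ G0) _ h, Multiset.card_cons]
      push Not at h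
      obtain ⟨g, hg, hg0⟩ := h
      have h1 : a.count g ≤ ∑ g ∈ Finset.univ.filter (fun g => g ∉ G0), a.count g :=
        Finset.single_le_sum (f := fun g => a.count g) (fun _ _ => Nat.zero_le _) (by simp [hg0])
      have h2 := Multiset.one_le_count_iff_mem.2 hg
      omega

/-- families of sets of lengths with difference `d` and elasticity at least `p / q` -/
def Fam (Γ : Type*) [AddCommGroup Γ] (d p q : ℕ) : Prop :=
  ∀ k : ℕ, ∃ L ∈ systemL (Set.univ : Set Γ), (∀ a ∈ L, ∀ b ∈ L, (d : ℤ) ∣ (a : ℤ) - b) ∧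
    ∃ a ∈ L, ∃ b ∈ L, k ≤ a ∧ p * a ≤ q * b

theorem TL [Fintype Γ] {n d p q α β : ℕ} (hn0 : 0 < n) (hΓ : ∀ g : Γ, n • g = 0)
    (hfam : Fam Γ d p q)
    (h : ∀ G0 : Set Γ, DvdD d G0 → ∀ A, IsMinZeroSum G0 A → α ≤ wt n A ∧ wt n A ≤ β) :
    p * α ≤ q * β := by
  have h1 : ∀ k : ℕ, ∃ s t : Multiset (Multiset Γ), Fac Set.univ s ∧ Fac Set.univ t ∧ s.sum = t.sum ∧
      k ≤ Multiset.card s ∧ p * Multiset.card s ≤ q * Multiset.card t ∧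
      ∀ u v, Fac Set.univ u → Fac Set.univ v → u.sum = s.sum → v.sum = s.sum →
        (d : ℤ) ∣ (Multiset.card u : ℤ) - Multiset.card v := by
    intro k
    obtain ⟨L, ⟨B, hB, rfl⟩, hd, a, ha, b, hb, hk, hab⟩ := hfam k
    obtain ⟨s, hs, hs2, rfl⟩ := mem_lengthSet_iff.1 ha
    obtain ⟨t, ht, ht2, rfl⟩ := mem_lengthSet_iff.1 hb
    refine ⟨s, t, hs, ht, by rw [hs2, ht2], hk, hab, fun u v hu hv hu2 hv2 => hd _ ?_ _ ?_⟩
    · exact mem_lengthSet_iff.2 ⟨u, hu, by rw [hu2, hs2], rfl⟩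
    · exact mem_lengthSet_iff.2 ⟨v, hv, by rw [hv2, hs2], rfl⟩
  choose s t hs ht hst hk hpq hdd using h1
  set U := Filter.hyperfilter ℕ with hU
  set G0 : Set Γ := {g | ∀ M, ∀ᶠ k in (U : Filter ℕ), M ≤ (s k).sum.count g} with hG0
  have hbad : ∀ g, ∃ M, g ∉ G0 → ∀ᶠ k in (U : Filter ℕ), (s k).sum.count g ≤ M := by
    intro g
    by_cases hg : g ∈ G0
    · exact ⟨0, fun h => absurd hg h⟩
    · simp only [hG0, Set.mem_ofPred_eq, not_forall] at hg
      obtain ⟨M, hM⟩ := hg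
      refine ⟨M, fun _ => ?_⟩
      rw [← Ultrafilter.eventually_not] at hM
      exact hM.mono fun k hk => by omega
  choose M hM using hbad
  have hDv : DvdD d G0 := by
    intro u v hu hv huv
    have hev : ∀ᶠ k in (U : Filter ℕ), ∀ g, u.sum.count g ≤ (s k).sum.count g := by
      rw [Filter.eventually_all]
      intro g
      by_cases hg : g ∈ u.sum
      · exact hu.mem g hg _
      · rw [Multiset.count_eq_zero.2 hg]
        exact Filter.Eventually.of_forall fun k => Nat.zero_le _
    obtain ⟨k, hk⟩ := hev.exists
    have hle : u.sum ≤ (s k).sum := Multiset.le_iff_count.2 hk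
    obtain ⟨w, hw, hw2⟩ := exists_fac (G0 := (Set.univ : Set Γ)) (B := (s k).sum - u.sum)
      ⟨fun _ _ => Set.mem_univ _, by rw [sum_sub_eq hle, hu.sum_sum, (hs k).sum_sum, sub_zero]⟩
    have := hdd k (u + w) (v + w) ((hu.mono (Set.subset_univ _)).add hw)
      ((hv.mono (Set.subset_univ _)).add hw)
      (by rw [Multiset.sum_add, hw2, add_comm, Multiset.sub_add_cancel hle])
      (by rw [Multiset.sum_add, hw2, ← huv, add_comm, Multiset.sub_add_cancel hle])
    simpa using this
  have hAtom := h G0 hDv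
  set C := ∑ g : Γ, M g with hC
  set W := n * (Fintype.card Γ * n) with hW
  have hev : ∀ᶠ k in (U : Filter ℕ), ∀ g, g ∉ G0 → (s k).sum.count g ≤ M g := by
    rw [Filter.eventually_all]
    intro g
    by_cases hg : g ∈ G0
    · exact Filter.Eventually.of_forall fun k h => absurd hg h
    · exact (hM g hg).mono fun k hk _ => hk
  have hge : ∀ᶠ k in (U : Filter ℕ), q * (C * W + α * C) + 1 ≤ k := by
    have h1 : (U : Filter ℕ) ≤ Filter.atTop := by
      rw [← Nat.cofinite_eq_atTop]; exact Filter.hyperfilter_le_cofinite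
    exact h1 (Filter.eventually_ge_atTop _)
  obtain ⟨k, hk1, hk2⟩ := (hev.and hge).exists
  have hbadsum : ∑ g ∈ Finset.univ.filter (fun g => g ∉ G0), (s k).sum.count g ≤ C := by
    refine (Finset.sum_le_sum (g := M) fun g hg => hk1 g (by simpa using hg)).trans ?_
    exact Finset.sum_le_sum_of_subset (Finset.filter_subset _ _)
  have hsplit : ∀ u : Multiset (Multiset Γ), u = u.filter (fun A => ∀ g ∈ A, g ∈ G0) +
      u.filter (fun A => ¬ ∀ g ∈ A, g ∈ G0) := fun u => (Multiset.filter_add_not _ u).symm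
  have hgood : ∀ u, Fac Set.univ u → Fac G0 (u.filter (fun A => ∀ g ∈ A, g ∈ G0)) := by
    intro u hu A hA
    rw [Multiset.mem_filter] at hA
    exact IsMinZeroSum.mono' (hu A hA.1) hA.2
  have hup : wt n (s k).sum ≤ β * Multiset.card (s k) + C * W := by
    have e1 := congrArg (fun u => wt n (Multiset.sum u)) (hsplit (s k))
    have e2 := congrArg Multiset.card (hsplit (s k))
    simp only [Multiset.sum_add, wt_add] at e1
    rw [Multiset.card_add] at e2
    have e3 := wt_sum_le (n := n) (a := β) fun A hA => (hAtom A (hgood _ (hs k) A hA)).2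
    have e4 : wt n ((s k).filter (fun A => ¬ ∀ g ∈ A, g ∈ G0)).sum ≤
        Multiset.card ((s k).filter (fun A => ¬ ∀ g ∈ A, g ∈ G0)) * W :=
      wt_sum_le fun A hA => (wt_le_card A).trans (Nat.mul_le_mul_left _
        (atom_card_le hn0 hΓ (hs k A (Multiset.mem_of_mem_filter hA))))
    have e5 := Nat.mul_le_mul_right W ((bad_card G0 (s k)).trans hbadsum)
    have e6 : Multiset.card ((s k).filter (fun A => ∀ g ∈ A, g ∈ G0)) * β ≤ β * Multiset.card (s k) := by
      rw [mul_comm]; exact Nat.mul_le_mul_left _ (by omega)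
    omega
  have hlow : α * Multiset.card (t k) ≤ wt n (s k).sum + α * C := by
    have e1 := congrArg (fun u => wt n (Multiset.sum u)) (hsplit (t k))
    have e2 := congrArg Multiset.card (hsplit (t k))
    simp only [Multiset.sum_add, wt_add] at e1
    rw [Multiset.card_add] at e2
    have e3 := le_wt_sum (n := n) (a := α) fun A hA => (hAtom A (hgood _ (ht k) A hA)).1
    have e5 : Multiset.card ((t k).filter (fun A => ¬ ∀ g ∈ A, g ∈ G0)) ≤ C := (bad_card G0 (t k)).trans (by rw [← hst k]; exact hbadsum)
    have e6 := Nat.mul_le_mul_left α e5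
    rw [hst k, e1, e2, mul_add]
    rw [mul_comm] at e3
    omega
  by_contra hcon
  have hcon' : q * β + 1 ≤ p * α := by omega
  have f1 : (q * β + 1) * Multiset.card (s k) ≤ p * α * Multiset.card (s k) := Nat.mul_le_mul_right _ hcon'
  have f2 : α * (p * Multiset.card (s k)) ≤ α * (q * Multiset.card (t k)) := Nat.mul_le_mul_left _ (hpq k)
  have f3 : q * (α * Multiset.card (t k)) ≤ q * (β * Multiset.card (s k) + C * W + α * C) :=
    Nat.mul_le_mul_left _ (by omega)
  have f4 := hk k
  nlinarith

theorem fam_aux {n d : ℕ} {g : Γ} {s : Multiset (Multiset Γ)}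
    (h : ∀ A ∈ s, ∃ c : ℤ, (Multiset.card A : ℤ) = n + d * c ∧ (n : ℤ) ∣ c + A.count g) :
    ∃ c : ℤ, (Multiset.card s.sum : ℤ) = n * Multiset.card s + d * c ∧ (n : ℤ) ∣ c + s.sum.count g := by
  induction s using Multiset.induction_on with
  | empty => exact ⟨0, by simp⟩
  | cons a s ih =>
    obtain ⟨c, h1, h2⟩ := h a (by simp)
    obtain ⟨c', h3, h4⟩ := ih fun A hA => h A (by simp [hA])
    refine ⟨c + c', ?_, ?_⟩
    · rw [Multiset.sum_cons, Multiset.card_add, Multiset.card_cons]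
      push_cast
      linear_combination h1 + h3
    · rw [Multiset.sum_cons, Multiset.count_add]
      push_cast
      have e : (c + c') + ((a.count g : ℤ) + (s.sum.count g : ℤ)) = (c + a.count g) + (c' + s.sum.count g) := by ring
      rw [e]; exact dvd_add h2 h4

theorem fam_cong {n d : ℕ} (hn0 : 0 < n) (g : Γ) {E : Set Γ} {B : Multiset Γ} (hB : ∀ x ∈ B, x ∈ E)
    (h : ∀ A, IsMinZeroSum E A →
      ∃ c : ℤ, (Multiset.card A : ℤ) = n + d * c ∧ (n : ℤ) ∣ c + A.count g) :
    ∀ a ∈ lengthSet Set.univ B, ∀ b ∈ lengthSet Set.univ B, (d : ℤ) ∣ (a : ℤ) - b := by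
  intro a ha b hb
  obtain ⟨s, hs, hs2, rfl⟩ := mem_lengthSet_iff.1 ha
  obtain ⟨t, ht, ht2, rfl⟩ := mem_lengthSet_iff.1 hb
  have hs' : Fac E s := hs.restrict (by rw [hs2]; exact hB)
  have ht' : Fac E t := ht.restrict (by rw [ht2]; exact hB)
  obtain ⟨c, h1, h2⟩ := fam_aux fun A hA => h A (hs' A hA)
  obtain ⟨c', h3, h4⟩ := fam_aux fun A hA => h A (ht' A hA)
  rw [hs2] at h1 h2
  rw [ht2] at h3 h4
  obtain ⟨m, hm⟩ := dvd_sub h4 h2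
  refine ⟨m, mul_left_cancel₀ (a := (n : ℤ)) (by omega) ?_⟩
  linear_combination h3 - h1 + d * hm

theorem finset_val_sum (E : Finset Γ) : E.val.sum = ∑ x ∈ E, x := by
  rw [Finset.sum_eq_multiset_sum, Multiset.map_id']

theorem count_finset_val (E : Finset Γ) (x : Γ) : E.val.count x = if x ∈ E then 1 else 0 := by
  by_cases h : x ∈ E
  · simp only [h, if_true]; exact Multiset.count_eq_one_of_mem E.nodup h
  · simp only [h, if_false]; exact Multiset.count_eq_zero.2 h

theorem F4 {n d t : ℕ} (hΓ : ∀ g : Γ, n • g = 0) (E : Finset Γ)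
    (hE : E.card = t) (ht : 2 ≤ t) (hd : 1 ≤ d) (htd : t + d = n)
    (hsum : ∑ x ∈ E, x = 0)
    (hrel : ∀ a : Γ → ℕ, ∑ x ∈ E, a x • x = 0 → ∀ x ∈ E, ∀ y ∈ E, (n : ℤ) ∣ (a x : ℤ) - a y) :
    Fam Γ d n t := by
  have hn0 : 0 < n := by omega
  have hrel' : ∀ A : Multiset Γ, A.sum = 0 → (∀ x ∈ A, x ∈ E) → ∀ x ∈ E, ∀ y ∈ E,
      (n : ℤ) ∣ (A.count x : ℤ) - A.count y := fun A hA hm =>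
    hrel (fun x => A.count x) (by rw [← sum_eq_finset A hm, hA])
  have hord : ∀ x ∈ E, addOrderOf x = n := by
    intro x hx
    obtain ⟨y, hy, hyx⟩ := Finset.exists_mem_ne (by omega : 1 < E.card) x
    have h1 := hrel' (OO x) (sum_replicate_order x) (fun z hz => by
      rw [OO] at hz; rw [Multiset.eq_of_mem_replicate hz]; exact hx) x hx y hy
    rw [OO, Multiset.count_replicate_self, Multiset.count_replicate, if_neg (Ne.symm hyx)] at h1
    refine Nat.dvd_antisymm (order_dvd hΓ x) ?_
    have : (n : ℤ) ∣ (addOrderOf x : ℤ) := by simpa using h1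
    exact_mod_cast this
  have hcases : ∀ A : Multiset Γ, A.sum = 0 → (∀ x ∈ A, x ∈ E) → A ≠ 0 →
      E.val ≤ A ∨ ∃ x ∈ E, OO x ≤ A := by
    intro A hA hm h0
    by_cases hall : ∀ x ∈ E, x ∈ A
    · left
      exact (Multiset.le_iff_subset E.nodup).2 fun x hx => hall x hx
    · right
      push Not at hall
      obtain ⟨y, hy, hyA⟩ := hall
      obtain ⟨x, hx⟩ := Multiset.exists_mem_of_ne_zero h0
      refine ⟨x, hm x hx, Multiset.le_count_iff_replicate_le.1 ?_⟩
      have h1 := hrel' A hA hm x (hm x hx) y hy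
      rw [Multiset.count_eq_zero.2 hyA] at h1
      rw [hord x (hm x hx)]
      refine Nat.le_of_dvd (Multiset.count_pos.2 hx) ?_
      have : (n : ℤ) ∣ (A.count x : ℤ) := by simpa using h1
      exact_mod_cast this
  have hEatom : IsMinZeroSum (E : Set Γ) E.val := by
    refine ⟨?_, fun x hx => hx, by rw [finset_val_sum, hsum], fun T hT hTs => ?_⟩
    · intro h
      have : E.card = 0 := by rw [Finset.card, h]; rfl
      omega
    · by_cases h0 : T = 0
      · exact Or.inl h0
      · right
        rcases hcases T hTs (fun x hx => Multiset.mem_of_le hT hx) h0 with h | ⟨x, hx, h⟩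
        · exact le_antisymm hT h
        · exfalso
          have h1 := Multiset.le_count_iff_replicate_le.2 h
          have h2 := Multiset.le_iff_count.1 hT x
          rw [count_finset_val, if_pos hx] at h2
          rw [hord x hx] at h1
          omega
  have hne : E.Nonempty := Finset.card_pos.1 (by omega)
  obtain ⟨g, hg⟩ := hne
  intro k
  refine ⟨_, ⟨(n * k) • E.val, ⟨fun _ _ => Set.mem_univ _, ?_⟩, rfl⟩, ?_, t * k, ?_, n * k, ?_, ?_, ?_⟩
  · rw [Multiset.sum_nsmul, finset_val_sum, hsum, smul_zero]
  · refine fam_cong (E := (E : Set Γ)) hn0 g (fun x hx => Multiset.mem_of_mem_nsmul hx) fun A hA => ?_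
    rcases hcases A hA.2.2.1 hA.2.1 hA.1 with h | ⟨x, hx, h⟩
    · rcases hA.2.2.2 _ h hEatom.2.2.1 with h1 | h1
      · exact absurd h1 hEatom.1
      · refine ⟨-1, ?_, ?_⟩
        · rw [← h1]
          have : Multiset.card E.val = t := hE
          rw [this]; push_cast [← htd]; ring
        · rw [← h1, count_finset_val, if_pos hg]; simp
    · have h1 := atom_eq_of_order_le hA (order_pos hn0 hΓ x) (Multiset.le_count_iff_replicate_le.2 h)
      refine ⟨0, ?_, ?_⟩
      · rw [h1]; simp [hord x hx]
      · rw [h1, Multiset.count_replicate, hord x hx]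
        split <;> simp
  · refine mem_lengthSet_iff.2 ⟨k • E.val.map OO, ?_, ?_, ?_⟩
    · intro A hA
      exact fac_OO hn0 hΓ (fun _ _ => Set.mem_univ _) A (Multiset.mem_of_mem_nsmul hA)
    · rw [Multiset.sum_nsmul]
      have : (E.val.map OO).sum = n • E.val := by
        rw [Multiset.map_congr rfl (g := fun x => n • {x})]
        · rw [Multiset.sum_map_nsmul, Multiset.sum_map_singleton]
        · intro x hx
          rw [OO, hord x hx, Multiset.nsmul_singleton]
      rw [this, ← mul_smul, mul_comm]
    · rw [Multiset.card_nsmul, Multiset.card_map]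
      have : Multiset.card E.val = t := hE
      rw [this]; simp [mul_comm]
  · exact mem_lengthSet_iff.2 ⟨Multiset.replicate (n * k) E.val,
      Fac.replicate (IsMinZeroSum.mono hEatom (Set.subset_univ _)) _, by simp, by simp⟩
  · nlinarith
  · nlinarith

theorem F2 {p d : ℕ} (hp : p.Prime) (E : Finset Γ) (hd : 1 ≤ d)
    (hE : E.card = d + 1) (hpE : ∀ x ∈ E, p • x = 0)
    (hrel : ∀ a : Γ → ℕ, ∑ x ∈ E, a x • x = 0 → ∀ x ∈ E, p ∣ a x) :
    Fam Γ d (1 + (d + 1) * (p - 1)) p := by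
  have hp2 := hp.two_le
  set g := ∑ x ∈ E, x with hg
  have hpg : p • g = 0 := by
    rw [hg, Finset.smul_sum]; exact Finset.sum_eq_zero hpE
  have hgE : g ∉ E := by
    intro h
    obtain ⟨y, hy, hyx⟩ := Finset.exists_mem_ne (by omega : 1 < E.card) g
    have h1 := hrel (fun x => if x = g then 0 else 1) (by
      simp only [ite_smul, zero_smul, one_smul]
      rw [← Finset.add_sum_erase E _ h, if_pos rfl, zero_add]
      have h2 : g = g + ∑ x ∈ E.erase g, x := by
        conv_lhs => rw [hg]
        rw [Finset.add_sum_erase E (fun x => x) h]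
      have h3 : ∑ x ∈ E.erase g, x = 0 := by simpa using h2
      rw [← h3]
      refine Finset.sum_congr rfl fun x hx => if_neg (Finset.ne_of_mem_erase hx)) y hy
    simp only [if_neg hyx] at h1
    exact hp.one_lt.ne' (Nat.dvd_one.1 h1)
  have hx0 : ∀ x ∈ E, x ≠ 0 := by
    rintro x hx rfl
    have h1 := hrel (fun y => if y = 0 then 1 else 0) (by
      refine Finset.sum_eq_zero fun y _ => ?_
      by_cases h : y = 0 <;> simp [h]) 0 hx
    simp only [if_true] at h1
    exact hp.one_lt.ne' (Nat.dvd_one.1 h1)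
  have hg0 : g ≠ 0 := by
    intro h
    obtain ⟨y, hy⟩ : E.Nonempty := Finset.card_pos.1 (by omega)
    have h1 := hrel (fun _ => 1) (by simp only [one_smul]; rw [← hg]; exact h) y hy
    exact hp.one_lt.ne' (Nat.dvd_one.1 h1)
  haveI : Fact p.Prime := ⟨hp⟩
  have hordg : addOrderOf g = p := addOrderOf_eq_prime hpg hg0
  have hordE : ∀ x ∈ E, addOrderOf x = p := fun x hx => addOrderOf_eq_prime (hpE x hx) (hx0 x hx)
  have hrel' : ∀ A : Multiset Γ, A.sum = 0 → (∀ x ∈ A, x ∈ insert g E) → ∀ x ∈ E,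
      p ∣ A.count x + A.count g := by
    intro A hA hm
    refine hrel (fun x => A.count x + A.count g) ?_
    rw [sum_eq_finset A hm, Finset.sum_insert hgE] at hA
    simp only [add_smul]
    rw [Finset.sum_add_distrib, ← Finset.smul_sum, ← hg, add_comm]
    exact hA
  set V := g ::ₘ (p - 1) • E.val with hV
  have hVg : V.count g = 1 := by
    rw [hV, Multiset.count_cons_self, Multiset.count_nsmul, count_finset_val, if_neg hgE]; simp
  have hVx : ∀ x ∈ E, V.count x = p - 1 := by
    intro x hx
    have hne : x ≠ g := by rintro rfl; exact hgE hx
    rw [hV, Multiset.count_cons_of_ne hne, Multiset.count_nsmul, count_finset_val, if_pos hx]; simp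
  have hVm : ∀ x ∈ V, x ∈ insert g E := by
    intro x hx
    rcases Multiset.mem_cons.1 hx with rfl | h
    · simp
    · exact Finset.mem_insert_of_mem (Multiset.mem_of_mem_nsmul h)
  have hVs : V.sum = 0 := by
    rw [hV, Multiset.sum_cons, Multiset.sum_nsmul, finset_val_sum, ← hg, ← succ_nsmul']
    rw [show p - 1 + 1 = p by omega, hpg]
  have hVatom : IsMinZeroSum (Set.univ : Set Γ) V := by
    refine ⟨by rw [hV]; simp, fun _ _ => Set.mem_univ _, hVs, fun T hT hTs => ?_⟩
    have hTm : ∀ x ∈ T, x ∈ insert g E := fun x hx => hVm x (Multiset.mem_of_le hT hx)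
    have h1 := hrel' T hTs hTm
    have h2 := Multiset.le_iff_count.1 hT
    have h3 := h2 g
    rw [hVg] at h3
    have hTc : T.count g = 0 ∨ T.count g = 1 := by omega
    rcases hTc with h0 | h0
    · left
      rw [Multiset.eq_zero_iff_forall_notMem]
      intro x hx
      have hx1 := Multiset.count_pos.2 hx
      rcases Finset.mem_insert.1 (hTm x hx) with rfl | hxE
      · omega
      · have h4 := h1 x hxE
        have h5 := h2 x
        rw [hVx x hxE] at h5
        have := Nat.le_of_dvd (by omega) h4
        omega
    · right
      refine le_antisymm hT (Multiset.le_iff_count.2 fun x => ?_)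
      by_cases hx : x ∈ V
      · rcases Finset.mem_insert.1 (hVm x hx) with rfl | hxE
        · omega
        · have := Nat.le_of_dvd (by omega) (h1 x hxE)
          rw [hVx x hxE]; omega
      · rw [Multiset.count_eq_zero.2 hx]; omega
  intro k
  refine ⟨_, ⟨(p * k) • V, ⟨fun _ _ => Set.mem_univ _, ?_⟩, rfl⟩, ?_, p * k, ?_,
    k * (1 + (d + 1) * (p - 1)), ?_, ?_, ?_⟩
  · rw [Multiset.sum_nsmul, hVs, smul_zero]
  · refine fam_cong (E := ((insert g E : Finset Γ) : Set Γ)) hp.pos g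
      (fun x hx => hVm x (Multiset.mem_of_mem_nsmul hx)) fun A hA => ?_
    by_cases hc : ∃ x ∈ insert g E, p ≤ A.count x
    · obtain ⟨x, hx, hxp⟩ := hc
      have hordx : addOrderOf x = p := by
        rcases Finset.mem_insert.1 hx with rfl | h
        exacts [hordg, hordE x h]
      have h1 := atom_eq_of_order_le hA (by rw [hordx]; exact hp.pos) (by rw [hordx]; exact hxp)
      refine ⟨0, ?_, ?_⟩
      · rw [h1]; simp [hordx]
      · rw [h1, Multiset.count_replicate, hordx]
        split <;> simp
    · push Not at hc
      have h1 := hrel' A hA.2.2.1 hA.2.1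
      have hgp := hc g (by simp)
      have hj : 1 ≤ A.count g := by
        by_contra h
        apply hA.1
        rw [Multiset.eq_zero_iff_forall_notMem]
        intro x hx
        have hx1 := Multiset.count_pos.2 hx
        rcases Finset.mem_insert.1 (hA.2.1 x hx) with rfl | hxE
        · omega
        · have := Nat.le_of_dvd (by omega) (h1 x hxE)
          have := hc x (by simp [hxE])
          omega
      have hcx : ∀ x ∈ E, A.count x = p - A.count g := by
        intro x hxE
        have h3 := hc x (by simp [hxE])
        obtain ⟨m, hm⟩ := h1 x hxE
        have : m = 1 := by
          have : m < 2 := by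
            by_contra h
            have : p * 2 ≤ p * m := Nat.mul_le_mul_left _ (by omega)
            omega
          have : m ≠ 0 := by rintro rfl; omega
          omega
        subst this
        omega
      refine ⟨(p - A.count g : ℕ), ?_, ?_⟩
      · rw [← Multiset.sum_count_eq_card (s := insert g E) (fun a ha => hA.2.1 a ha), Finset.sum_insert hgE,
          Finset.sum_congr rfl hcx, Finset.sum_const, hE]
        push_cast [Nat.cast_sub hgp.le, smul_eq_mul]
        ring
      · rw [Nat.cast_sub hgp.le]; simp
  · exact mem_lengthSet_iff.2 ⟨Multiset.replicate (p * k) V, Fac.replicate hVatom _, by simp, by simp⟩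
  · refine mem_lengthSet_iff.2 ⟨k • ((g ::ₘ (p - 1) • E.val).map OO), ?_, ?_, ?_⟩
    · intro A hA
      obtain ⟨x, hx, rfl⟩ := Multiset.mem_map.1 (Multiset.mem_of_mem_nsmul hA)
      refine atom_replicate (Set.mem_univ _) ?_
      rcases Finset.mem_insert.1 (hVm x hx) with rfl | h
      · rw [hordg]; exact hp.pos
      · rw [hordE x h]; exact hp.pos
    · rw [Multiset.sum_nsmul]
      have : (V.map OO).sum = p • V := by
        rw [Multiset.map_congr rfl (g := fun x => p • {x})]
        · rw [Multiset.sum_map_nsmul, Multiset.sum_map_singleton]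
        · intro x hx
          rcases Finset.mem_insert.1 (hVm x hx) with rfl | h
          · rw [OO, hordg, Multiset.nsmul_singleton]
          · rw [OO, hordE x h, Multiset.nsmul_singleton]
      rw [← hV, this, ← mul_smul, mul_comm]
    · rw [Multiset.card_nsmul, Multiset.card_map, Multiset.card_cons, Multiset.card_nsmul]
      have : Multiset.card E.val = d + 1 := hE
      rw [this]; ring
  · nlinarith
  · nlinarith

theorem exists_indep_vec {V : Type*} [AddCommGroup V] [Finite V] {p d : ℕ} [Fact p.Prime] [Module (ZMod p) V]
    (h : p ^ d < Nat.card V) : ∃ v : Fin (d + 1) → V, LinearIndependent (ZMod p) v := by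
  rw [← FiniteField.pow_finrank_eq_natCard p V] at h
  have hlt : d + 1 ≤ Module.finrank (ZMod p) V :=
    (Nat.pow_lt_pow_iff_right (Fact.out : p.Prime).one_lt).1 h
  let b := Module.finBasis (ZMod p) V
  exact ⟨fun i => b (Fin.castLE hlt i), b.linearIndependent.comp _ (Fin.castLE_injective hlt)⟩

theorem exists_indep [Finite Γ] {p d : ℕ} (hp : p.Prime)
    (h : p ^ d < Nat.card {g : Γ // p • g = 0}) :
    ∃ E : Finset Γ, E.card = d + 1 ∧ (∀ x ∈ E, p • x = 0) ∧
      ∀ a : Γ → ℕ, ∑ x ∈ E, a x • x = 0 → ∀ x ∈ E, p ∣ a x := by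
  have : Fact p.Prime := ⟨hp⟩
  let T : AddSubgroup Γ := (nsmulAddMonoidHom p : Γ →+ Γ).ker
  have hT : ∀ x : Γ, x ∈ T ↔ p • x = 0 := fun x => Iff.rfl
  letI : Module (ZMod p) T := AddCommGroup.zmodModule fun x => Subtype.ext ((hT x).1 x.2)
  have hcard2 : Nat.card {g : Γ // p • g = 0} = Nat.card T := rfl
  rw [hcard2] at h
  obtain ⟨v, hv⟩ := exists_indep_vec h
  let w : Fin (d + 1) → Γ := fun i => (v i : Γ)
  have hw : Function.Injective w := fun i j hij => hv.injective (Subtype.ext hij)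
  refine ⟨Finset.univ.image w, ?_, ?_, ?_⟩
  · rw [Finset.card_image_of_injective _ hw]; simp
  · intro x hx
    obtain ⟨i, _, rfl⟩ := Finset.mem_image.1 hx
    exact (hT _).1 (v i).2
  · intro a ha x hx
    obtain ⟨i, _, rfl⟩ := Finset.mem_image.1 hx
    rw [Finset.sum_image (fun i _ j _ hij => hw hij)] at ha
    have h1 : ∑ i, (a (w i) : ZMod p) • v i = 0 := by
      apply Subtype.ext
      simp only [Nat.cast_smul_eq_nsmul]
      rw [AddSubgroup.val_finsetSum]
      simpa using ha
    have h2 := Fintype.linearIndependent_iff.1 hv _ h1 i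
    exact (ZMod.natCast_eq_zero_iff _ _).1 h2

theorem bdd_dav [Fintype Γ] :
    BddAbove {m | ∃ A : Multiset Γ, IsMinZeroSum (Set.univ : Set Γ) A ∧ Multiset.card A = m} := by
  refine ⟨Fintype.card Γ * Fintype.card Γ, ?_⟩
  rintro m ⟨A, hA, rfl⟩
  exact atom_card_le Fintype.card_pos (fun g => card_nsmul_eq_zero) hA

theorem le_dav [Fintype Γ] {A : Multiset Γ} (hA : IsMinZeroSum (Set.univ : Set Γ) A) :
    Multiset.card A ≤ davenport Γ := le_csSup bdd_dav ⟨A, hA, rfl⟩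

theorem atom_zero : IsMinZeroSum (Set.univ : Set Γ) {0} := by
  refine ⟨by simp, fun _ _ => Set.mem_univ _, by simp, fun T hT _ => ?_⟩
  exact Multiset.le_singleton.1 hT |>.imp id id

theorem exists_dav [Fintype Γ] :
    ∃ A : Multiset Γ, IsMinZeroSum (Set.univ : Set Γ) A ∧ Multiset.card A = davenport Γ :=
  Nat.sSup_mem (s := {m | ∃ A : Multiset Γ, IsMinZeroSum (Set.univ : Set Γ) A ∧ Multiset.card A = m}) ⟨1, {0}, atom_zero, by simp⟩ bdd_dav

theorem atom_zero_mem {A : Multiset Γ} (hA : IsMinZeroSum (Set.univ : Set Γ) A) (h : (0 : Γ) ∈ A) :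
    A = {0} := by
  rcases hA.2.2.2 {0} (Multiset.singleton_le.2 h) (by simp) with h1 | h1
  · simp at h1
  · exact h1.symm

theorem atom_f [Fintype Γ] {A : Multiset Γ} (hA : IsMinZeroSum (Set.univ : Set Γ) A) :
    2 ≤ Multiset.card A + A.count 0 ∧ Multiset.card A + A.count 0 ≤ max (davenport Γ) 2 := by
  by_cases h : (0 : Γ) ∈ A
  · rw [atom_zero_mem hA h]; simp
  · rw [Multiset.count_eq_zero.2 h]
    refine ⟨?_, (le_dav hA).trans (le_max_left _ _)⟩
    have h0 : Multiset.card A ≠ 0 := by simpa using hA.1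
    have h1 : Multiset.card A ≠ 1 := by
      intro h1
      obtain ⟨a, rfl⟩ := Multiset.card_eq_one.1 h1
      have := hA.2.2.1
      simp at this
      simp [this] at h
    omega

theorem fac_f [Fintype Γ] {s : Multiset (Multiset Γ)} (hs : Fac Set.univ s) :
    2 * Multiset.card s ≤ Multiset.card s.sum + s.sum.count 0 ∧
    Multiset.card s.sum + s.sum.count 0 ≤ max (davenport Γ) 2 * Multiset.card s := by
  induction s using Multiset.induction_on with
  | empty => simp
  | cons a s ih =>
    have h1 := ih fun A hA => hs A (by simp [hA])
    have h2 := atom_f (hs a (by simp))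
    rw [Multiset.sum_cons, Multiset.card_add, Multiset.count_add, Multiset.card_cons, mul_add, mul_add]
    constructor <;> omega

theorem two_mem_le [Fintype Γ] {L : Set ℕ} (hL : L ∈ systemL (Set.univ : Set Γ)) {m : ℕ}
    (h2 : 2 ∈ L) (hm : m ∈ L) : m ≤ max (davenport Γ) 2 := by
  obtain ⟨B, hB, rfl⟩ := hL
  obtain ⟨s, hs, hs2, hs3⟩ := mem_lengthSet_iff.1 h2
  obtain ⟨t, ht, ht2, rfl⟩ := mem_lengthSet_iff.1 hm
  have h1 := (fac_f hs).2
  have h3 := (fac_f ht).1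
  rw [hs2, hs3] at h1
  rw [ht2] at h3
  omega

theorem le_map_exists {α β : Type*} {f : α → β} {U : Multiset α} {T : Multiset β} (h : T ≤ U.map f) :
    ∃ T' ≤ U, T = T'.map f := by
  induction U using Multiset.induction_on generalizing T with
  | empty => exact ⟨0, le_rfl, by simpa using h⟩
  | cons a U ih =>
    rw [Multiset.map_cons] at h
    by_cases ha : f a ∈ T
    · obtain ⟨T', h1, h2⟩ := ih (Multiset.erase_le_iff_le_cons.2 h)
      exact ⟨a ::ₘ T', Multiset.cons_le_cons _ h1, by rw [Multiset.map_cons, ← h2, Multiset.cons_erase ha]⟩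
    · obtain ⟨T', h1, h2⟩ := ih ((Multiset.le_cons_of_notMem ha).1 h)
      exact ⟨T', h1.trans (Multiset.le_cons_self _ _), h2⟩

theorem le_cons_cases {α : Type*} {a : α} {T W : Multiset α} (h : T ≤ a ::ₘ W) :
    T ≤ W ∨ ∃ T' ≤ W, T = a ::ₘ T' := by
  by_cases ha : a ∈ T
  · exact Or.inr ⟨T.erase a, Multiset.erase_le_iff_le_cons.2 h, (Multiset.cons_erase ha).symm⟩
  · exact Or.inl ((Multiset.le_cons_of_notMem ha).1 h)

theorem map_hom_sum {Δ : Type*} [AddCommGroup Δ] (φ : Δ →+ Γ) (T : Multiset Δ) :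
    (T.map φ).sum = φ T.sum := (map_multiset_sum φ T).symm

theorem atom_map {Δ : Type*} [AddCommGroup Δ] (φ : Δ →+ Γ) (hφ : Function.Injective φ) {U : Multiset Δ}
    (hU : IsMinZeroSum Set.univ U) : IsMinZeroSum Set.univ (U.map φ) := by
  refine ⟨by simpa using hU.1, fun _ _ => Set.mem_univ _, by rw [map_hom_sum, hU.2.2.1, map_zero], ?_⟩
  intro T hT hTs
  obtain ⟨T', h1, rfl⟩ := le_map_exists hT
  rw [map_hom_sum] at hTs
  have h2 : T'.sum = 0 := hφ (by rw [hTs, map_zero])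
  rcases hU.2.2.2 T' h1 h2 with rfl | rfl <;> simp

theorem atom_pair {g : Γ} (hg : g ≠ 0) : IsMinZeroSum Set.univ (g ::ₘ ({-g} : Multiset Γ)) := by
  refine ⟨by simp, fun _ _ => Set.mem_univ _, by simp, fun T hT hTs => ?_⟩
  rcases le_cons_cases hT with h | ⟨T', h, rfl⟩
  · rcases Multiset.le_singleton.1 h with rfl | rfl
    · simp
    · simp at hTs; exact absurd hTs hg
  · rcases Multiset.le_singleton.1 h with rfl | rfl
    · simp at hTs; exact absurd hTs hg
    · simp

theorem exists_two_dav [Fintype Γ] (hD : 2 ≤ davenport Γ) :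
    ∃ L ∈ systemL (Set.univ : Set Γ), 2 ∈ L ∧ davenport Γ ∈ L := by
  obtain ⟨U, hU, hUc⟩ := exists_dav (Γ := Γ)
  have h0 : ∀ g ∈ U, g ≠ 0 := by
    rintro g hg rfl
    rw [atom_zero_mem hU hg] at hUc
    simp at hUc; omega
  have hs : ∀ U : Multiset Γ, (U.map fun g => g ::ₘ ({-g} : Multiset Γ)).sum = U + U.map (fun g => -g) := by
    intro U
    rw [show (fun g : Γ => g ::ₘ ({-g} : Multiset Γ)) = fun g => {g} + {-g} from rfl,
      Multiset.sum_map_add, Multiset.sum_map_singleton]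
    congr 1
    rw [← Multiset.sum_map_singleton (U.map fun g => -g), Multiset.map_map]; rfl
  have hneg : IsMinZeroSum Set.univ (U.map fun g => -g) :=
    atom_map (negAddMonoidHom : Γ →+ Γ) neg_injective hU
  refine ⟨_, ⟨U + U.map (fun g => -g), ⟨fun _ _ => Set.mem_univ _, ?_⟩, rfl⟩, ?_, ?_⟩
  · rw [Multiset.sum_add, hU.2.2.1, hneg.2.2.1, add_zero]
  · refine mem_lengthSet_iff.2 ⟨U ::ₘ {U.map fun g => -g}, ?_, by simp, by simp⟩
    intro A hA
    rcases Multiset.mem_cons.1 hA with rfl | h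
    · exact hU
    · rw [Multiset.mem_singleton.1 h]; exact hneg
  · refine mem_lengthSet_iff.2 ⟨_, ?_, hs U, by simp [hUc]⟩
    intro A hA
    obtain ⟨g, hg, rfl⟩ := Multiset.mem_map.1 hA
    exact atom_pair (h0 g hg)

theorem dav_le {Δ : Type*} [AddCommGroup Δ] [Fintype Γ] [Fintype Δ] (hD : 3 ≤ davenport Γ)
    (hL : systemL (Set.univ : Set Γ) = systemL (Set.univ : Set Δ)) : davenport Γ ≤ davenport Δ := by
  obtain ⟨L, h1, h2, h3⟩ := exists_two_dav (Γ := Γ) (by omega)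
  rw [hL] at h1
  have := two_mem_le h1 h2 h3
  omega

theorem dav_eq {Δ : Type*} [AddCommGroup Δ] [Fintype Γ] [Fintype Δ] (hD : 3 ≤ davenport Γ)
    (hL : systemL (Set.univ : Set Γ) = systemL (Set.univ : Set Δ)) : davenport Γ = davenport Δ := by
  have h := dav_le hD hL
  exact le_antisymm h (dav_le (by omega) hL.symm)

theorem dav_inj {Δ : Type*} [AddCommGroup Δ] [Fintype Γ] [Fintype Δ] (φ : Δ →+ Γ)
    (hφ : Function.Injective φ) (hD : davenport Γ ≤ davenport Δ) : Function.Surjective φ := by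
  by_contra hs
  unfold Function.Surjective at hs
  push Not at hs
  obtain ⟨g, hg⟩ := hs
  obtain ⟨U, hU, hUc⟩ := exists_dav (Γ := Δ)
  obtain ⟨h, hh⟩ := Multiset.exists_mem_of_ne_zero hU.1
  obtain ⟨U', rfl⟩ := Multiset.exists_cons_of_mem hh
  have hs0 : h + U'.sum = 0 := by simpa using hU.2.2.1
  have key : IsMinZeroSum Set.univ ((φ h - g) ::ₘ g ::ₘ U'.map φ) := by
    refine ⟨by simp, fun _ _ => Set.mem_univ _, ?_, ?_⟩
    · rw [Multiset.sum_cons, Multiset.sum_cons, map_hom_sum, ← add_assoc, sub_add_cancel, ← map_add, hs0, map_zero]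
    · intro T hT hTs
      rcases le_cons_cases hT with h1 | ⟨T1, h1, rfl⟩
      · rcases le_cons_cases h1 with h2 | ⟨T2, h2, rfl⟩
        · obtain ⟨T3, h3, rfl⟩ := le_map_exists h2
          rw [map_hom_sum] at hTs
          have h4 : T3.sum = 0 := hφ (by rw [hTs, map_zero])
          rcases hU.2.2.2 T3 (h3.trans (Multiset.le_cons_self _ _)) h4 with rfl | rfl
          · simp
          · exfalso
            have := Multiset.card_le_card h3
            simp at this
        · exfalso
          obtain ⟨T3, h3, rfl⟩ := le_map_exists h2
          rw [Multiset.sum_cons, map_hom_sum] at hTs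
          exact hg (-T3.sum) (by rw [map_neg]; exact (eq_neg_of_add_eq_zero_left hTs).symm)
      · rcases le_cons_cases h1 with h2 | ⟨T2, h2, rfl⟩
        · exfalso
          obtain ⟨T3, h3, rfl⟩ := le_map_exists h2
          rw [Multiset.sum_cons, map_hom_sum] at hTs
          refine hg (h + T3.sum) ?_
          rw [map_add, ← sub_eq_zero, ← hTs]; abel
        · obtain ⟨T3, h3, rfl⟩ := le_map_exists h2
          rw [Multiset.sum_cons, Multiset.sum_cons, map_hom_sum, ← add_assoc, sub_add_cancel, ← map_add] at hTs
          have h4 : (h ::ₘ T3).sum = 0 := by rw [Multiset.sum_cons]; exact hφ (by rw [hTs, map_zero])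
          rcases hU.2.2.2 _ (Multiset.cons_le_cons _ h3) h4 with h5 | h5
          · simp at h5
          · rw [Multiset.cons_inj_right] at h5
            subst h5; simp
  have := le_dav key
  simp at this hUc
  omega

theorem dav_surj {Δ : Type*} [AddCommGroup Δ] [Fintype Γ] [Fintype Δ] (ψ : Γ →+ Δ)
    (hψ : Function.Surjective ψ) (hD : davenport Γ ≤ davenport Δ) : Function.Injective ψ := by
  rw [injective_iff_map_eq_zero]
  by_contra hs
  push Not at hs
  obtain ⟨κ, hκ, hκ0⟩ := hs
  obtain ⟨U, hU, hUc⟩ := exists_dav (Γ := Δ)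
  obtain ⟨u, hu⟩ := Multiset.exists_mem_of_ne_zero hU.1
  obtain ⟨U', rfl⟩ := Multiset.exists_cons_of_mem hu
  have hs0 : u + U'.sum = 0 := by simpa using hU.2.2.1
  obtain ⟨σ, hσ⟩ := hψ.hasRightInverse
  set W := U'.map σ with hW
  have hWψ : W.map ψ = U' := by
    rw [hW, Multiset.map_map]
    conv_rhs => rw [← Multiset.map_id U']
    exact Multiset.map_congr rfl fun x _ => hσ x
  set x := -W.sum - κ with hx
  have hxψ : ψ x = u := by
    rw [hx, map_sub, map_neg, hκ, ← map_hom_sum, hWψ, sub_zero]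
    exact (eq_neg_of_add_eq_zero_left hs0).symm
  have h2 : ∀ T ≤ x ::ₘ W, ψ T.sum = 0 → T = 0 ∨ T = x ::ₘ W := by
    intro T hT hTs
    have h3 : T.map ψ ≤ u ::ₘ U' := by
      have := Multiset.map_le_map (f := ψ) hT
      rwa [Multiset.map_cons, hxψ, hWψ] at this
    rcases hU.2.2.2 _ h3 (by rw [map_hom_sum, hTs]) with h4 | h4
    · left; simpa using h4
    · right
      refine Multiset.eq_of_le_of_card_le hT ?_
      have := congrArg Multiset.card h4
      rw [Multiset.card_map] at this
      rw [this, hW]; simp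
  have key : IsMinZeroSum Set.univ (κ ::ₘ x ::ₘ W) := by
    refine ⟨by simp, fun _ _ => Set.mem_univ _, ?_, ?_⟩
    · rw [Multiset.sum_cons, Multiset.sum_cons, hx]; abel
    · intro T hT hTs
      rcases le_cons_cases hT with h1 | ⟨T1, h1, rfl⟩
      · rcases h2 T h1 (by rw [hTs, map_zero]) with h | rfl
        · exact Or.inl h
        · exfalso
          rw [Multiset.sum_cons, hx] at hTs
          apply hκ0
          rw [← neg_eq_zero, ← hTs]; abel
      · rw [Multiset.sum_cons] at hTs
        rcases h2 T1 h1 (by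
          have := congrArg ψ hTs
          rwa [map_add, hκ, zero_add, map_zero] at this) with rfl | rfl
        · exfalso; simp at hTs; exact hκ0 hTs
        · exact Or.inr rfl
  have := le_dav key
  simp [hW] at this hUc
  omega

theorem atom4 {a b c e : Γ} (hs : a + b + c + e = 0) (ha : a ≠ 0) (hb : b ≠ 0) (hc : c ≠ 0) (he : e ≠ 0)
    (hab : a + b ≠ 0) (hac : a + c ≠ 0) (hbc : b + c ≠ 0) :
    IsMinZeroSum Set.univ (a ::ₘ b ::ₘ c ::ₘ ({e} : Multiset Γ)) := by
  refine ⟨by simp, fun _ _ => Set.mem_univ _, by simp; rw [← hs]; abel, fun T hT hTs => ?_⟩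
  have h1 : a + b + c ≠ 0 := fun h => he (by rw [h] at hs; simpa using hs)
  have h2 : a + b + e ≠ 0 := fun h => hc (by
    have : c = (a + b + c + e) - (a + b + e) := by abel
    rw [this, hs, h, sub_zero])
  have h3 : a + c + e ≠ 0 := fun h => hb (by
    have : b = (a + b + c + e) - (a + c + e) := by abel
    rw [this, hs, h, sub_zero])
  have h4 : b + c + e ≠ 0 := fun h => ha (by
    have : a = (a + b + c + e) - (b + c + e) := by abel
    rw [this, hs, h, sub_zero])
  have h5 : c + e ≠ 0 := fun h => hab (by
    have : a + b = (a + b + c + e) - (c + e) := by abel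
    rw [this, hs, h, sub_zero])
  have h6 : b + e ≠ 0 := fun h => hac (by
    have : a + c = (a + b + c + e) - (b + e) := by abel
    rw [this, hs, h, sub_zero])
  have h7 : a + e ≠ 0 := fun h => hbc (by
    have : b + c = (a + b + c + e) - (a + e) := by abel
    rw [this, hs, h, sub_zero])
  rcases le_cons_cases hT with h | ⟨T, h, rfl⟩ <;> rcases le_cons_cases h with h' | ⟨T, h', rfl⟩ <;>
  rcases le_cons_cases h' with h'' | ⟨T, h'', rfl⟩ <;>
  rcases Multiset.le_singleton.1 h'' with rfl | rfl <;>
  simp_all [← add_assoc]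

theorem C8_exists {x y z : Γ} (hx : x + x = 0) (hy : y + y = 0) (hz : z + z = 0)
    (h1 : x ≠ 0) (h2 : y ≠ 0) (h3 : z ≠ 0) (h4 : x + y ≠ 0) (h5 : x + z ≠ 0) (h6 : y + z ≠ 0)
    (h7 : x + y + z ≠ 0) : ∃ L ∈ systemL (Set.univ : Set Γ), 3 ∈ L ∧ 6 ∈ L := by
  have hdd : ∀ a : Γ, a + a = 0 → a ≠ 0 → IsMinZeroSum Set.univ (a ::ₘ ({a} : Multiset Γ)) := by
    intro a ha h0
    have := atom_pair h0
    rwa [neg_eq_of_add_eq_zero_left ha] at this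
  have U1 : IsMinZeroSum Set.univ (x ::ₘ (x + y) ::ₘ (x + z) ::ₘ ({x + y + z} : Multiset Γ)) := by
    refine atom4 ?_ h1 h4 h5 h7 ?_ ?_ ?_
    · rw [show x + (x + y) + (x + z) + (x + y + z) = (x + x) + (x + x) + (y + y) + (z + z) by abel, hx, hy, hz]; simp
    · rw [← add_assoc, hx, zero_add]; exact h2
    · rw [← add_assoc, hx, zero_add]; exact h3
    · rw [show x + y + (x + z) = (x + x) + (y + z) by abel, hx, zero_add]; exact h6
  have U2 : IsMinZeroSum Set.univ (y ::ₘ (x + y) ::ₘ (y + z) ::ₘ ({x + y + z} : Multiset Γ)) := by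
    refine atom4 ?_ h2 h4 h6 h7 ?_ ?_ ?_
    · rw [show y + (x + y) + (y + z) + (x + y + z) = (x + x) + (y + y) + (y + y) + (z + z) by abel, hx, hy, hz]; simp
    · rw [show y + (x + y) = (y + y) + x by abel, hy, zero_add]; exact h1
    · rw [← add_assoc, hy, zero_add]; exact h3
    · rw [show x + y + (y + z) = (y + y) + (x + z) by abel, hy, zero_add]; exact h5
  have U3 : IsMinZeroSum Set.univ (x ::ₘ y ::ₘ (x + z) ::ₘ ({y + z} : Multiset Γ)) := by
    refine atom4 ?_ h1 h2 h5 h6 h4 ?_ ?_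
    · rw [show x + y + (x + z) + (y + z) = (x + x) + (y + y) + (z + z) by abel, hx, hy, hz]; simp
    · rw [← add_assoc, hx, zero_add]; exact h3
    · rw [show y + (x + z) = x + y + z by abel]; exact h7
  refine ⟨_, ⟨(x ::ₘ (x + y) ::ₘ (x + z) ::ₘ ({x + y + z} : Multiset Γ)) +
    (y ::ₘ (x + y) ::ₘ (y + z) ::ₘ ({x + y + z} : Multiset Γ)) +
    (x ::ₘ y ::ₘ (x + z) ::ₘ ({y + z} : Multiset Γ)), ⟨fun _ _ => Set.mem_univ _, ?_⟩, rfl⟩, ?_, ?_⟩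
  · rw [Multiset.sum_add, Multiset.sum_add, U1.2.2.1, U2.2.2.1, U3.2.2.1]; simp
  · refine mem_lengthSet_iff.2 ⟨(x ::ₘ (x + y) ::ₘ (x + z) ::ₘ ({x + y + z} : Multiset Γ)) ::ₘ
    (y ::ₘ (x + y) ::ₘ (y + z) ::ₘ ({x + y + z} : Multiset Γ)) ::ₘ
    {x ::ₘ y ::ₘ (x + z) ::ₘ ({y + z} : Multiset Γ)}, ?_, ?_, by simp⟩
    · intro A hA
      simp only [Multiset.mem_cons, Multiset.mem_singleton] at hA
      rcases hA with rfl | rfl | rfl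
      exacts [U1, U2, U3]
    · simp only [Multiset.sum_cons, Multiset.sum_singleton, add_assoc]
  · refine mem_lengthSet_iff.2 ⟨(x ::ₘ {x}) ::ₘ (y ::ₘ {y}) ::ₘ ((x + y) ::ₘ {x + y}) ::ₘ
      ((x + z) ::ₘ {x + z}) ::ₘ ((y + z) ::ₘ {y + z}) ::ₘ {(x + y + z) ::ₘ {x + y + z}}, ?_, ?_, by simp⟩
    · intro A hA
      simp only [Multiset.mem_cons, Multiset.mem_singleton] at hA
      have e1 : (x + y) + (x + y) = 0 := by
        rw [show (x + y) + (x + y) = (x + x) + (y + y) by abel, hx, hy, add_zero]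
      have e2 : (x + z) + (x + z) = 0 := by
        rw [show (x + z) + (x + z) = (x + x) + (z + z) by abel, hx, hz, add_zero]
      have e3 : (y + z) + (y + z) = 0 := by
        rw [show (y + z) + (y + z) = (y + y) + (z + z) by abel, hz, hy, add_zero]
      have e4 : (x + y + z) + (x + y + z) = 0 := by
        rw [show (x + y + z) + (x + y + z) = (x + x) + (y + y) + (z + z) by abel, hx, hz, hy]; simp
      rcases hA with rfl | rfl | rfl | rfl | rfl | rfl
      exacts [hdd _ hx h1, hdd _ hy h2, hdd _ e1 h4, hdd _ e2 h5, hdd _ e3 h6, hdd _ e4 h7]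
    · simp only [Multiset.sum_cons, Multiset.sum_singleton]
      simp only [← Multiset.singleton_add]
      abel

theorem C4_atom {g : Γ} (hg : addOrderOf g = 4) (hall : ∀ x : Γ, x = 0 ∨ x = g ∨ x = g + g ∨ x = -g)
    {A : Multiset Γ} (hA : IsMinZeroSum Set.univ A) :
    2 ≤ Multiset.card A + A.count 0 ∧ Multiset.card A + A.count 0 ≤ 4 ∧
    (Multiset.card A + A.count 0 = 2 → (A.count g : ℤ) - A.count (-g) = 0) ∧
    (Multiset.card A + A.count 0 = 4 → (A.count g : ℤ) - A.count (-g) = 4 ∨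
      (A.count g : ℤ) - A.count (-g) = -4) := by
  have hz : ∀ k : ℤ, k • g = 0 ↔ 4 ∣ k := by
    intro k
    rw [← addOrderOf_dvd_iff_zsmul_eq_zero, hg]; rfl
  have n1 : g ≠ 0 := fun h => by have := (hz 1).1 (by simpa using h); omega
  have n2 : g + g ≠ 0 := fun h => by have := (hz 2).1 (by rw [two_zsmul]; exact h); omega
  have n3 : -g ≠ 0 := by simpa using n1
  have n4 : g ≠ g + g := by simpa using n1
  have n5 : g ≠ -g := fun h => n2 (by nth_rewrite 2 [h]; simp)
  have h4 : (g + g) + (g + g) = 0 := by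
    have := (hz 4).2 (by norm_num)
    rw [← this]; abel
  have n6 : g + g ≠ -g := fun h => by
    have := (hz 3).1 (by rw [show (3 : ℤ) • g = (g + g) + g by abel, h]; simp)
    omega
  by_cases c0 : (0 : Γ) ∈ A
  · rw [atom_zero_mem hA c0]
    simp [n1, n3, Multiset.count_singleton]
  by_cases c1 : 2 ≤ A.count (g + g)
  · rcases hA.2.2.2 _ (Multiset.le_count_iff_replicate_le.1 c1) (by
      rw [Multiset.sum_replicate, two_nsmul, h4]) with h | h
    · simp at h
    · rw [← h]
      simp only [Multiset.count_replicate, Multiset.card_replicate]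
      simp [n1, n1.symm, n2, n2.symm, n3, n3.symm, n4, n4.symm, n5, n5.symm, n6, n6.symm]
  by_cases c2 : g ∈ A ∧ -g ∈ A
  · have hle : g ::ₘ {-g} ≤ A := by
      refine (Multiset.le_iff_subset (by simp [n5])).2 fun x hx => ?_
      simp at hx
      rcases hx with rfl | rfl
      exacts [c2.1, c2.2]
    rcases hA.2.2.2 _ hle (by simp) with h | h
    · simp at h
    · rw [← h]
      simp [Multiset.count_cons, Multiset.count_singleton, n1, n1.symm, n3, n3.symm, n5, n5.symm]
  by_cases c3 : 4 ≤ A.count g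
  · rcases hA.2.2.2 _ (Multiset.le_count_iff_replicate_le.1 c3) (by
      rw [Multiset.sum_replicate, ← h4]; abel) with h | h
    · simp at h
    · rw [← h]
      simp only [Multiset.count_replicate, Multiset.card_replicate]
      simp [n1, n1.symm, n2, n2.symm, n3, n3.symm, n4, n4.symm, n5, n5.symm, n6, n6.symm]
  by_cases c4 : 4 ≤ A.count (-g)
  · rcases hA.2.2.2 _ (Multiset.le_count_iff_replicate_le.1 c4) (by
      rw [Multiset.sum_replicate, ← neg_zero, ← h4]; abel) with h | h
    · simp at h
    · rw [← h]
      simp only [Multiset.count_replicate, Multiset.card_replicate]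
      simp [n1, n1.symm, n2, n2.symm, n3, n3.symm, n4, n4.symm, n5, n5.symm, n6, n6.symm]
  have hm : ∀ x ∈ A, x ∈ ({g, g + g, -g} : Finset Γ) := by
    intro x hx
    rcases hall x with rfl | h | h | h
    · exact absurd hx c0
    all_goals simp [h]
  have hsum := sum_eq_finset A hm
  have hcard := Multiset.sum_count_eq_card hm
  rw [Finset.sum_insert (by simp [n4, n5]), Finset.sum_insert (by simp [n6]), Finset.sum_singleton] at hsum hcard
  rw [hA.2.2.1] at hsum
  have hd := (hz ((A.count g : ℤ) + (2 * (A.count (g + g) : ℤ) - A.count (-g)))).1 (by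
    rw [hsum, add_smul, sub_smul, mul_comm, mul_smul, two_zsmul, natCast_zsmul, natCast_zsmul, natCast_zsmul, smul_neg]
    abel)
  have hA0 : Multiset.card A ≠ 0 := by simpa using hA.1
  rw [Multiset.count_eq_zero.2 c0]
  have c2' : A.count g = 0 ∨ A.count (-g) = 0 := by
    simp only [Multiset.count_eq_zero]; tauto
  omega

theorem C4_not {g : Γ} (hg : addOrderOf g = 4) (hall : ∀ x : Γ, x = 0 ∨ x = g ∨ x = g + g ∨ x = -g)
    {L : Set ℕ} (hL : L ∈ systemL (Set.univ : Set Γ)) (h3 : 3 ∈ L) (h6 : 6 ∈ L) : False := by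
  obtain ⟨B, hB, rfl⟩ := hL
  obtain ⟨s, hs, hs2, hs3⟩ := mem_lengthSet_iff.1 h3
  obtain ⟨t, ht, ht2, ht3⟩ := mem_lengthSet_iff.1 h6
  have key : ∀ t : Multiset (Multiset Γ), Fac Set.univ t →
      2 * Multiset.card t ≤ Multiset.card t.sum + t.sum.count 0 ∧
      (Multiset.card t.sum + t.sum.count 0 = 2 * Multiset.card t →
        (t.sum.count g : ℤ) - t.sum.count (-g) = 0) := by
    intro t ht
    induction t using Multiset.induction_on with
    | empty => simp
    | cons a t ih =>
      have h1 := ih fun A hA => ht A (by simp [hA])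
      have h2 := C4_atom hg hall (ht a (by simp))
      simp only [Multiset.sum_cons, Multiset.card_add, Multiset.count_add, Multiset.card_cons]
      push_cast
      omega
  have h1 := key t ht
  rw [ht2, ht3] at h1
  obtain ⟨A1, A2, A3, rfl⟩ := Multiset.card_eq_three.1 hs3
  have a1 := C4_atom hg hall (hs A1 (by simp))
  have a2 := C4_atom hg hall (hs A2 (by simp))
  have a3 := C4_atom hg hall (hs A3 (by simp))
  have e : B = A1 + A2 + A3 := by rw [← hs2]; simp [add_assoc]
  rw [e] at h1
  simp only [Multiset.card_add, Multiset.count_add] at h1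
  push_cast at h1
  omega

theorem TorLe.mono {r s : ℕ} (h : TorLe Γ r) (hrs : r ≤ s) : TorLe Γ s := fun p hp =>
  (h p hp).trans (Nat.pow_le_pow_right hp.pos hrs)

theorem exists_enum (F : Finset Γ) {r : ℕ} (h : F.card ≤ r) : ∃ y : Fin r → Γ, ∀ f ∈ F, ∃ i, y i = f := by
  refine ⟨fun i => if h : (i : ℕ) < F.card then (F.equivFin.symm ⟨i, h⟩ : Γ) else 0, fun f hf => ?_⟩
  refine ⟨⟨F.equivFin ⟨f, hf⟩, lt_of_lt_of_le (F.equivFin ⟨f, hf⟩).2 h⟩, ?_⟩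
  simp

theorem gen_lemma [Finite Γ] {n r : ℕ} (hn0 : 0 < n) (hΓ : ∀ g : Γ, n • g = 0) (ht : TorLe Γ r) :
    ∃ x : Fin r → Γ, AddSubgroup.closure (Set.range x) = ⊤ := by
  have : Fintype Γ := Fintype.ofFinite Γ
  have h1 : ∀ p : ℕ, ∃ y : Fin r → Γ, p.Prime → ∀ K : AddSubgroup Γ,
      (∀ i, ordCompl[p] n • y i ∈ K) → ∀ f, ordCompl[p] n • f ∈ K := by
    intro p
    by_cases hp : p.Prime
    · obtain ⟨F', -, hc, hF⟩ := rank_lemma hΓ (Nat.ordProj_mul_ordCompl_eq_self n p).symm hp (ht p hp) Finset.univ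
      obtain ⟨y, hy⟩ := exists_enum F' hc
      refine ⟨y, fun _ K hK f => ?_⟩
      refine (AddSubgroup.closure_le K).2 ?_ (hF f (Finset.mem_univ _))
      intro z hz
      obtain ⟨w, hw, rfl⟩ := Finset.mem_image.1 (Finset.mem_coe.1 hz)
      obtain ⟨i, rfl⟩ := hy w hw
      exact hK i
    · exact ⟨0, fun h => absurd h hp⟩
  choose y hy using h1
  let x : Fin r → Γ := fun i => ∑ p ∈ n.primeFactors, ordCompl[p] n • y p i
  refine ⟨x, ?_⟩
  set K := AddSubgroup.closure (Set.range x) with hK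
  have hxK : ∀ i, x i ∈ K := fun i => AddSubgroup.subset_closure ⟨i, rfl⟩
  have hdvd : ∀ p : ℕ, p.Prime → ∀ p' : ℕ, p'.Prime → p' ≠ p → n ∣ ordCompl[p] n * ordCompl[p'] n := by
    intro p hp p' hp' hne
    have h2 : ordProj[p'] n ∣ ordCompl[p] n := by
      have h3 : ordProj[p'] n ∣ ordProj[p] n * ordCompl[p] n := by
        rw [Nat.ordProj_mul_ordCompl_eq_self]; exact Nat.ordProj_dvd n p'
      exact Nat.Coprime.dvd_of_dvd_mul_left
        (Nat.Coprime.pow _ _ ((Nat.coprime_primes hp' hp).2 hne)) h3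
    have h4 := Nat.mul_dvd_mul_right h2 (ordCompl[p'] n)
    rwa [Nat.ordProj_mul_ordCompl_eq_self] at h4
  have hq : ∀ p ∈ n.primeFactors, ∀ f, ordCompl[p] n • f ∈ K := by
    intro p hpn
    have hp := Nat.prime_of_mem_primeFactors hpn
    refine hy p hp K fun i => ?_
    have h2 : ordCompl[p] n • x i = (ordCompl[p] n * ordCompl[p] n) • y p i := by
      simp only [x]
      rw [Finset.smul_sum, Finset.sum_eq_single p]
      · rw [mul_smul]
      · intro p' hp' hne
        rw [← mul_smul]
        obtain ⟨c, hc⟩ := hdvd p hp p' (Nat.prime_of_mem_primeFactors hp') hne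
        rw [hc, mul_comm, mul_smul, hΓ, smul_zero]
      · intro h; exact absurd hpn h
    have h3 : (ordCompl[p] n * ordCompl[p] n) • y p i ∈ K := by
      rw [← h2]; exact AddSubgroup.nsmul_mem _ (hxK i) _
    have hcop : Nat.Coprime (ordCompl[p] n) (ordProj[p] n) :=
      (Nat.Coprime.pow_left _ (Nat.coprime_ordCompl hp hn0.ne')).symm
    obtain ⟨u, v, huv⟩ := Nat.isCoprime_iff_coprime.2 hcop
    have h4 : ordCompl[p] n • y p i = u • ((ordCompl[p] n * ordCompl[p] n) • y p i) := by
      have h5 : (((ordCompl[p] n : ℕ) : ℤ)) • y p i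
          = ((u * (ordCompl[p] n : ℕ) + v * (ordProj[p] n : ℕ)) * (ordCompl[p] n : ℕ)) • y p i := by
        rw [huv, one_mul]
      rw [natCast_zsmul] at h5
      rw [h5, add_mul, add_smul, mul_assoc, mul_assoc, ← Nat.cast_mul, ← Nat.cast_mul,
        mul_smul, mul_smul v]
      rw [Nat.ordProj_mul_ordCompl_eq_self, natCast_zsmul, natCast_zsmul, hΓ, smul_zero,
        add_zero]
    rw [h4]
    exact AddSubgroup.zsmul_mem _ h3 _
  rw [eq_top_iff]
  intro f _
  rw [← QuotientAddGroup.eq_zero_iff, ← AddMonoid.addOrderOf_eq_one_iff]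
  by_contra hne
  obtain ⟨p, hp, hpm⟩ := Nat.exists_prime_and_dvd hne
  have hpn : p ∣ n := hpm.trans (addOrderOf_dvd_of_nsmul_eq_zero (by
    rw [← QuotientAddGroup.mk_nsmul, hΓ, QuotientAddGroup.mk_zero]))
  have h2 := hq p (Nat.mem_primeFactors.2 ⟨hp, hpn, hn0.ne'⟩) f
  rw [← QuotientAddGroup.eq_zero_iff, QuotientAddGroup.mk_nsmul] at h2
  have h3 := hpm.trans (addOrderOf_dvd_of_nsmul_eq_zero h2)
  exact Nat.not_dvd_ordCompl hp hn0.ne' h3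

theorem surj_lemma [Finite Γ] {n r : ℕ} (hn0 : 1 < n) (hΓ : ∀ g : Γ, n • g = 0) (ht : TorLe Γ r) :
    ∃ φ : (Fin r → ZMod n) →+ Γ, Function.Surjective φ := by
  have : NeZero n := ⟨by omega⟩
  have : Fact (1 < n) := ⟨hn0⟩
  obtain ⟨x, hx⟩ := gen_lemma (by omega) hΓ ht
  obtain ⟨φ, hφ⟩ := exists_hom hΓ x
  refine ⟨φ, AddMonoidHom.range_eq_top.1 ?_⟩
  rw [eq_top_iff, ← hx, AddSubgroup.closure_le]
  rintro _ ⟨i, rfl⟩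
  refine ⟨Pi.single i 1, ?_⟩
  rw [hφ, Finset.sum_eq_single i]
  · simp [ZMod.val_one]
  · intro j _ hj; simp [hj]
  · simp

theorem wt_ge2 {n : ℕ} (hn : 2 ≤ n) (hΓ : ∀ g : Γ, n • g = 0) {G0 : Set Γ} {A : Multiset Γ}
    (hA : IsMinZeroSum G0 A) (ho : ∀ g ∈ A, addOrderOf g = n) : 2 ≤ wt n A := by
  have h1 := card_le_wt (by omega) hΓ A
  have h0 : Multiset.card A ≠ 0 := by simpa using hA.1
  have h2 : Multiset.card A ≠ 1 := by
    intro h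
    obtain ⟨a, rfl⟩ := Multiset.card_eq_one.1 h
    have h3 := hA.2.2.1
    rw [Multiset.sum_singleton] at h3
    have h4 := ho a (by simp)
    rw [h3, addOrderOf_zero] at h4
    omega
  omega

theorem F4w {ι : Type*} [Fintype ι] {n d t : ℕ} (hΓ : ∀ g : Γ, n • g = 0) (w : ι → Γ)
    (hE : Fintype.card ι = t) (ht : 2 ≤ t) (hd : 1 ≤ d) (htd : t + d = n)
    (hsum : ∑ i, w i = 0)
    (hrel : ∀ a : ι → ℕ, ∑ i, a i • w i = 0 → ∀ i j, (n : ℤ) ∣ (a i : ℤ) - a j) :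
    Fam Γ d n t := by
  have hinj : Function.Injective w := by
    intro i j hij
    by_contra hne
    have h1 := hrel (Pi.single i 1 + Pi.single j (n - 1)) (by
      simp only [Pi.add_apply, add_smul, Finset.sum_add_distrib]
      rw [Finset.sum_eq_single i (by intro k _ hk; simp [hk]) (by simp),
        Finset.sum_eq_single j (by intro k _ hk; simp [hk]) (by simp), Pi.single_eq_same, Pi.single_eq_same,
        hij, ← add_smul, show 1 + (n - 1) = n by omega, hΓ]) i j
    simp only [Pi.add_apply, Pi.single_eq_same, Pi.single_eq_of_ne hne, Pi.single_eq_of_ne (Ne.symm hne)] at h1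
    have h2 : (n : ℤ) ∣ 2 := by
      have : (2 : ℤ) = ((1 + 0 : ℕ) : ℤ) - ((0 + (n - 1) : ℕ) : ℤ) + n := by
        push_cast [Nat.cast_sub (show 1 ≤ n by omega)]; ring
      rw [this]
      exact dvd_add h1 dvd_rfl
    have := Int.le_of_dvd (by norm_num) h2
    omega
  refine F4 hΓ (Finset.univ.image w) ?_ ht hd htd ?_ ?_
  · rw [Finset.card_image_of_injective _ hinj, Finset.card_univ, hE]
  · rw [Finset.sum_image (fun i _ j _ h => hinj h)]; exact hsum
  · intro a ha x hx y hy
    obtain ⟨i, _, rfl⟩ := Finset.mem_image.1 hx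
    obtain ⟨j, _, rfl⟩ := Finset.mem_image.1 hy
    rw [Finset.sum_image (fun i _ j _ h => hinj h)] at ha
    exact hrel (fun i => a (w i)) ha i j

theorem F4pair {n : ℕ} (hn : 3 ≤ n) (hΓ : ∀ g : Γ, n • g = 0) {h : Γ} (hh : addOrderOf h = n) :
    Fam Γ (n - 2) n 2 := by
  refine F4w (ι := Fin 2) hΓ ![h, -h] (by simp) le_rfl (by omega) (by omega) (by simp) ?_
  intro a ha
  have h1 : (n : ℤ) ∣ (a 0 : ℤ) - a 1 := by
    rw [← hh, addOrderOf_dvd_iff_zsmul_eq_zero, sub_smul, natCast_zsmul, natCast_zsmul]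
    simpa [sub_eq_add_neg] using ha
  have h2 : (n : ℤ) ∣ (a 1 : ℤ) - a 0 := by
    rw [← neg_sub]; exact (dvd_neg).2 h1
  intro i j
  fin_cases i <;> fin_cases j <;> simp [h1, h2]

theorem F4std {n r : ℕ} (e : Γ ≃+ (Fin r → ZMod n)) (hr : 1 ≤ r) (hrn : r + 2 ≤ n) :
    Fam Γ (n - r - 1) n (r + 1) := by
  have hΓ : ∀ g : Γ, n • g = 0 := fun g => e.injective (by
    rw [map_nsmul, map_zero]; ext i; simp)
  let w : Option (Fin r) → Γ := fun o => o.elim (e.symm fun _ => -1) fun i => e.symm (Pi.single i 1)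
  have hw : ∀ a : Option (Fin r) → ℕ, ∀ i, e (∑ o, a o • w o) i = (a (some i) : ZMod n) - a none := by
    intro a i
    rw [Fintype.sum_option, map_add, map_sum]
    simp only [map_nsmul, w, Option.elim, AddEquiv.apply_symm_apply]
    rw [Pi.add_apply, Finset.sum_apply, Finset.sum_eq_single i]
    · simp; ring
    · intro j _ hj; simp [Ne.symm hj]
    · simp
  refine F4w (ι := Option (Fin r)) hΓ w (by simp) (by omega) (by omega) (by omega) ?_ ?_
  · apply e.injective
    ext i
    have := hw (fun _ => 1) i
    simp only [one_smul] at this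
    rw [this]; simp
  · intro a ha
    have h1 : ∀ o, (n : ℤ) ∣ (a o : ℤ) - a none := by
      intro o
      rcases o with _ | i
      · simp
      · have := hw a i
        rw [ha, map_zero] at this
        rw [← ZMod.intCast_zmod_eq_zero_iff_dvd]
        push_cast
        rw [← this]; rfl
    intro i j
    have := dvd_sub (h1 i) (h1 j)
    simpa using this

theorem torLe_std {n r : ℕ} (hn0 : 0 < n) (e : Γ ≃+ (Fin r → ZMod n)) : TorLe Γ r := by
  intro p hp
  have : NeZero n := ⟨hn0.ne'⟩
  have h1 : Nat.card {y : ZMod n // p • y = 0} ≤ p := by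
    have := IsAddCyclic.card_nsmul_eq_zero_le (α := ZMod n) hp.pos
    rw [Nat.card_eq_fintype_card, Fintype.card_subtype]
    exact this
  have h2 : Nat.card {g : Γ // p • g = 0} ≤ Nat.card (Fin r → {y : ZMod n // p • y = 0}) := by
    refine Nat.card_le_card_of_injective (fun g i => ⟨e g.1 i, ?_⟩) ?_
    · rw [← Pi.smul_apply, ← map_nsmul, g.2, map_zero]; rfl
    · intro g g' h
      apply Subtype.ext
      apply e.injective
      ext i
      exact congrArg Subtype.val (congrFun h i)
  refine h2.trans ?_
  rw [Nat.card_fun, Nat.card_eq_fintype_card (α := Fin r), Fintype.card_fin]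
  exact Nat.pow_le_pow_left h1 r

theorem triv_dav [Fintype Γ] (h : ∀ g : Γ, g = 0) : davenport Γ ≤ 1 := by
  obtain ⟨A, hA, hAc⟩ := exists_dav (Γ := Γ)
  obtain ⟨x, hx⟩ := Multiset.exists_mem_of_ne_zero hA.1
  rw [h x] at hx
  rw [← hAc, atom_zero_mem hA hx]; simp

/-- bound on the torsion of the second group -/
theorem use2 {Δ : Type*} [AddCommGroup Δ] [Fintype Γ] [Fintype Δ] {n r d : ℕ} (hn0 : 0 < n)
    (hΓ : ∀ g : Γ, n • g = 0) (ht : TorLe Γ r) (hrd : r ≤ d) (hd1 : 1 ≤ d) (hnd : n ≤ 2 * d + 1) (hdn : d + 2 ≤ n)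
    (hL : systemL (Set.univ : Set Γ) = systemL (Set.univ : Set Δ)) {p : ℕ} (hp : p.Prime)
    (hc : p ^ d < Nat.card {g : Δ // p • g = 0}) : d + 2 = n ∧ p = 2 := by
  obtain ⟨E, h1, h2, h3⟩ := exists_indep hp hc
  have hf : Fam Γ d (1 + (d + 1) * (p - 1)) p := by
    have := F2 hp E hd1 h1 h2 h3
    unfold Fam at this ⊢
    rwa [hL]
  have h4 := TL (α := n - d) (β := n) hn0 hΓ hf fun G0 hG0 A hA => by
    rcases T2 hn0 hΓ ht hrd hnd hG0 hA with h | h <;> omega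
  obtain ⟨m, rfl⟩ := Nat.exists_eq_add_of_le hdn
  obtain ⟨k, rfl⟩ := Nat.exists_eq_add_of_le hp.two_le
  rw [show d + 2 + m - d = 2 + m by omega, show 2 + k - 1 = 1 + k by omega] at h4
  have h5 : d * (m + k + m * k) ≤ 0 := by nlinarith
  have h6 : m + k + m * k = 0 := by
    rcases Nat.mul_eq_zero.1 (Nat.le_zero.1 h5) with h | h
    · omega
    · exact h
  constructor <;> omega

theorem final_inj {Δ Ω : Type*} [AddCommGroup Δ] [AddCommGroup Ω] [Fintype Γ] [Fintype Δ] (e : Γ ≃+ Ω) (φ : Ω →+ Δ)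
    (hφ : Function.Injective φ) (hD : davenport Γ = davenport Δ) : Nonempty (Γ ≃+ Δ) := by
  have h1 : Function.Injective (φ.comp e.toAddMonoidHom) := hφ.comp e.injective
  have h2 := dav_inj _ h1 hD.ge
  exact ⟨AddEquiv.ofBijective _ ⟨h1, h2⟩⟩

theorem final_surj {Δ Ω : Type*} [AddCommGroup Δ] [AddCommGroup Ω] [Fintype Γ] [Fintype Δ] (e : Γ ≃+ Ω) (φ : Ω →+ Δ)
    (hφ : Function.Surjective φ) (hD : davenport Γ = davenport Δ) : Nonempty (Γ ≃+ Δ) := by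
  have h1 : Function.Surjective (φ.comp e.toAddMonoidHom) := hφ.comp e.surjective
  have h2 := dav_surj _ h1 hD.le
  exact ⟨AddEquiv.ofBijective _ ⟨h2, h1⟩⟩

theorem C4_tor {Δ : Type*} [AddCommGroup Δ] [Fintype Δ] (e : Γ ≃+ (Fin 1 → ZMod 4))
    (hL : systemL (Set.univ : Set Γ) = systemL (Set.univ : Set Δ))
    (hc : 2 ^ 2 < Nat.card {g : Δ // 2 • g = 0}) : False := by
  obtain ⟨E, h1, h2, h3⟩ := exists_indep Nat.prime_two hc
  obtain ⟨x, y, z, hxy, hxz, hyz, rfl⟩ := Finset.card_eq_three.1 h1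
  have key : ∀ a b c : ℕ, a • x + (b • y + c • z) = 0 → 2 ∣ a ∧ 2 ∣ b ∧ 2 ∣ c := by
    intro a b c h
    have h4 := h3 (fun u => if u = x then a else if u = y then b else c) (by
      rw [Finset.sum_insert (by simp [hxy, hxz]), Finset.sum_insert (by simp [hyz]), Finset.sum_singleton]
      simpa [hxy.symm, hxz.symm, hyz.symm] using h)
    refine ⟨?_, ?_, ?_⟩
    · simpa using h4 x (by simp)
    · simpa [hxy.symm] using h4 y (by simp)
    · simpa [hxz.symm, hyz.symm] using h4 z (by simp)
  obtain ⟨L, hL1, h3L, h6L⟩ := C8_exists (x := x) (y := y) (z := z)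
    (by rw [← two_nsmul]; exact h2 x (by simp)) (by rw [← two_nsmul]; exact h2 y (by simp))
    (by rw [← two_nsmul]; exact h2 z (by simp))
    (fun h => by have := key 1 0 0 (by simpa using h); omega)
    (fun h => by have := key 0 1 0 (by simpa using h); omega)
    (fun h => by have := key 0 0 1 (by simpa using h); omega)
    (fun h => by have := key 1 1 0 (by simpa using h); omega)
    (fun h => by have := key 1 0 1 (by simpa using h); omega)
    (fun h => by have := key 0 1 1 (by simpa using h); omega)
    (fun h => by have := key 1 1 1 (by simpa [add_assoc] using h); omega)
  rw [← hL] at hL1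
  have hg : addOrderOf (e.symm fun _ => 1) = 4 := by
    rw [AddEquiv.addOrderOf_eq]
    refine addOrderOf_eq_of_nsmul_and_div_prime_nsmul (by norm_num) (by decide) ?_
    intro p hp hpd
    have : p = 2 := by
      have h5 : p ∣ 2 ^ 2 := by simpa using hpd
      exact (Nat.prime_dvd_prime_iff_eq hp Nat.prime_two).1 (hp.dvd_of_dvd_pow h5)
    subst this
    decide
  refine C4_not hg (fun u => ?_) hL1 h3L h6L
  have : ∀ v : Fin 1 → ZMod 4, v = 0 ∨ v = (fun _ => 1) ∨ v = (fun _ => 1) + (fun _ => 1) ∨ v = -(fun _ => 1) := by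
    decide
  rcases this (e u) with h | h | h | h
  · left; apply e.injective; simpa using h
  · right; left; apply e.injective; simpa using h
  · right; right; left; apply e.injective; simpa using h
  · right; right; right; apply e.injective; simpa using h

theorem main {Δ : Type*} [AddCommGroup Δ] [Fintype Γ] [Fintype Δ] (n r : ℕ)
    (e : Γ ≃+ (Fin r → ZMod n)) (hD : 4 ≤ davenport Γ) (hrn : r ≤ n - 3)
    (hL : systemL (Set.univ : Set Γ) = systemL (Set.univ : Set Δ)) : Nonempty (Γ ≃+ Δ) := by
  have hr : 1 ≤ r := by
    by_contra h
    have hr0 : r = 0 := by omega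
    subst hr0
    have := triv_dav (Γ := Γ) fun g => e.injective (Subsingleton.elim _ _)
    omega
  have hn : 4 ≤ n := by omega
  have hn0 : 0 < n := by omega
  have hΓ : ∀ g : Γ, n • g = 0 := fun g => e.injective (by
    rw [map_nsmul, map_zero]; ext i; simp)
  have ht : TorLe Γ r := torLe_std hn0 e
  have hdav : davenport Γ = davenport Δ := dav_eq (by omega) hL
  have hfam : ∀ d p q, Fam Γ d p q ↔ Fam Δ d p q := by
    intro d p q; unfold Fam; rw [hL]
  obtain ⟨d, hd⟩ : ∃ d, (n ≤ 2 * r + 1 ∧ d = r) ∨ (2 * r + 2 ≤ n ∧ d + r + 1 = n) := by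
    by_cases h : n ≤ 2 * r + 1
    · exact ⟨r, Or.inl ⟨h, rfl⟩⟩
    · exact ⟨n - r - 1, Or.inr ⟨by omega, by omega⟩⟩
  have htd : TorLe Δ d := by
    by_cases hr1 : r = 1 ∧ 5 ≤ n
    · refine TorLe.mono (r := n - 3) ?_ (by omega)
      intro p hp
      by_contra hc
      have := use2 (d := n - 3) hn0 hΓ ht (by omega) (by omega) (by omega) (by omega) hL hp (by omega)
      omega
    · intro p hp
      by_contra hc
      have h1 := use2 (d := d) hn0 hΓ ht (by omega) (by omega) (by omega) (by omega) hL hp (by omega)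
      have hr' : r = 1 := by omega
      have hn' : n = 4 := by omega
      have hd' : d = 2 := by omega
      obtain ⟨-, rfl⟩ := h1
      subst hr' hn' hd'
      exact C4_tor e hL (by omega)
  obtain ⟨h, hh⟩ := AddMonoid.exists_addOrderOf_eq_exponent
    (AddMonoid.ExponentExists.of_finite (G := Δ))
  set N := AddMonoid.exponent Δ with hN
  have hΔ : ∀ g : Δ, N • g = 0 := fun g => AddMonoid.exponent_nsmul_eq_zero g
  have hN0 : 0 < N := by rw [← hh]; exact addOrderOf_pos h
  have hNn : N ≤ n := by
    by_contra hlt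
    have hf := (hfam _ _ _).2 (F4pair (by omega) hΔ hh)
    have h4 := TL (α := n) (β := n) hn0 hΓ hf fun G0 hG0 A hA => by
      rcases T2 hn0 hΓ ht (by omega) (by omega) hG0 hA with h | ⟨h, _, ho⟩
      · omega
      · have := wt_ge2 (by omega) hΓ hA ho
        omega
    have := Nat.le_of_mul_le_mul_right h4 hn0
    omega
  obtain ⟨g, hg⟩ : ∃ g : Γ, addOrderOf g = n := by
    refine ⟨e.symm (Pi.single ⟨0, hr⟩ 1), ?_⟩
    rw [AddEquiv.addOrderOf_eq]
    refine Nat.dvd_antisymm (addOrderOf_dvd_of_nsmul_eq_zero (by ext i; simp)) ?_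
    have h1 := congrFun (addOrderOf_nsmul_eq_zero (Pi.single (M := fun _ : Fin r => ZMod n) ⟨0, hr⟩ 1)) ⟨0, hr⟩
    rw [Pi.smul_apply, Pi.single_eq_same] at h1
    rw [← ZMod.natCast_eq_zero_iff]
    simpa using h1
  have hnN : n ≤ N := by
    by_contra hlt
    have hf := (hfam _ _ _).1 (F4pair (by omega) hΓ hg)
    have h4 := TL (α := N) (β := N) hN0 hΔ hf fun G0 hG0 A hA => by
      rcases T2 hN0 hΔ htd (by omega) (by omega) hG0 hA with h | ⟨h, _, ho⟩
      · omega
      · have := wt_ge2 (by omega) hΔ hA ho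
        omega
    have := Nat.le_of_mul_le_mul_right h4 hN0
    omega
  have hNe : N = n := le_antisymm hNn hnN
  rw [hNe] at hΔ
  rcases hd with ⟨h1, rfl⟩ | ⟨h1, h2⟩
  · obtain ⟨φ, hφ⟩ := surj_lemma (by omega) hΔ htd
    exact final_surj e φ hφ hdav
  · have hf := (hfam _ _ _).1 (F4std e hr (by omega))
    rw [show n - r - 1 = d by omega] at hf
    by_cases hall : ∀ (G0 : Set Δ), DvdD d G0 → ∀ A : Multiset Δ, IsMinZeroSum G0 A → wt n A = n
    · exfalso
      have h4 := TL (α := n) (β := n) hn0 hΔ hf fun G0 hG0 A hA => by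
        have := hall G0 hG0 A hA
        omega
      have := Nat.le_of_mul_le_mul_right h4 hn0
      omega
    · push Not at hall
      obtain ⟨G0, hG0, A, hA, hw⟩ := hall
      obtain ⟨φ, hφ⟩ := T3 hn0 hΔ htd (by omega) (by omega) h2 hG0 hA hw
      exact final_inj e φ hφ hdav

end SL

/-- If `G ≅ C_n^r` with `D(G) ≥ 4`, `r ≤ n − 3`, and
`𝓛(G) = 𝓛(G')` for a finite abelian group `G'`, then `G ≅ G'`. -/
theorem stmt0 {G G' : Type*} [AddCommGroup G] [Fintype G] [AddCommGroup G'] [Fintype G']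
    (n r : ℕ) (hG : Nonempty (G ≃+ (Fin r → ZMod n)))
    (hD : 4 ≤ davenport G)
    (hrn : r ≤ n - 3)
    (hL : systemL (Set.univ : Set G) = systemL (Set.univ : Set G')) :
    Nonempty (G ≃+ G') := by
  
  obtain ⟨e⟩ := hG
  exact SL.main n r e hD hrn hL
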